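/- arXiv:1905.00047 — 3 statements merged into one kernel-verified Lean document; each statement's English description precedes it below -/
import Mathlib

section
/- Define the Chevalley weight of a strong Bruhat cover v ⋖ v·t_{ij} (i<j) in S_n to be j − i. Then the sum over all saturated chains from the identity to the longest element w₀ of the product of Chevalley weights along the chain equals C(n,2)!. -/
open Equiv Finset
open scoped Classical

/-- Number of inversions (Coxeter length) of a permutation of `Fin n`. -/
def invCount {n : ℕ} (v : Equiv.Perm (Fin n)) : ℕ :=
  (Finset.univ.filter (fun p : Fin n × Fin n => p.1 < p.2 ∧ v p.2 < v p.1)).card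

/-- `a` statistic of a (candidate) cover `v ⋖ v·t_{ij}`. -/
def aQ {n : ℕ} (v : Equiv.Perm (Fin n)) (i j : Fin n) : ℕ :=
  (Finset.univ.filter (fun k : Fin n => k < i ∧ v i < v k ∧ v k < v j)).card

/-- `b` statistic. -/
def bQ {n : ℕ} (v : Equiv.Perm (Fin n)) (i j : Fin n) : ℕ :=
  (Finset.univ.filter (fun k : Fin n => i < k ∧ k < j ∧ v j < v k)).card

/-- `c` statistic. -/
def cQ {n : ℕ} (v : Equiv.Perm (Fin n)) (i j : Fin n) : ℕ :=
  (Finset.univ.filter (fun k : Fin n => j < k ∧ v i < v k ∧ v k < v j)).card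

/-- `d` statistic. -/
def dQ {n : ℕ} (v : Equiv.Perm (Fin n)) (i j : Fin n) : ℕ :=
  (Finset.univ.filter (fun k : Fin n => i < k ∧ k < j ∧ v k < v i)).card

/-- Covering relation in strong Bruhat order. -/
def BruhatCov {n : ℕ} (v w : Equiv.Perm (Fin n)) : Prop :=
  ∃ i j : Fin n, i < j ∧ w = v * Equiv.swap i j ∧ invCount w = invCount v + 1

/-- Weighted count of saturated chains from `v` to `w` in strong Bruhat order:
a saturated chain is a sequence `v = c 0 ⋖ c 1 ⋖ ⋯ ⋖ c m = w` of covers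
(its length is necessarily `m = ℓ(w) - ℓ(v)`), and the weight of a chain is the
product of the weights of its covering steps. -/
noncomputable def chainSum {n : ℕ} {R : Type*} [CommSemiring R]
    (wt : Equiv.Perm (Fin n) → Equiv.Perm (Fin n) → R)
    (v w : Equiv.Perm (Fin n)) : R :=
  ∑ c ∈ Finset.univ.filter
      (fun c : Fin (invCount w - invCount v + 1) → Equiv.Perm (Fin n) =>
        c 0 = v ∧ c (Fin.last _) = w ∧
          ∀ i : Fin (invCount w - invCount v), BruhatCov (c i.castSucc) (c i.succ)),
    ∏ i : Fin (invCount w - invCount v), wt (c i.castSucc) (c i.succ)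

/-- The Chevalley weight `j - i` of a cover `v ⋖ u = v·t_{ij}`. -/
def chevWt {n : ℕ} (v u : Equiv.Perm (Fin n)) : ℕ :=
  ∑ p ∈ Finset.univ.filter
      (fun p : Fin n × Fin n => p.1 < p.2 ∧ u = v * Equiv.swap p.1 p.2),
    ((p.2 : ℕ) - (p.1 : ℕ))

theorem sum_sum_eq_off_pair {α : Type*} [Fintype α] [DecidableEq α] {i j : α} (hij : i ≠ j)
    (G : α → α → ℕ) :
    ∑ p, ∑ q, G p q = ∑ p ∈ univ \ {i, j}, ∑ q ∈ univ \ {i, j}, G p q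
      + ∑ k ∈ univ \ {i, j}, (G k i + G k j + G i k + G j k)
      + (G i i + G i j + G j i + G j j) := by
  have split (f : α → ℕ) : ∑ p, f p = ∑ p ∈ univ \ {i, j}, f p + (f i + f j) := by
    rw [← Finset.sum_pair hij, Finset.sum_sdiff (Finset.subset_univ _)]
  rw [split]
  simp only [split (G _), Finset.sum_add_distrib]
  ring

theorem invCount_eq_sum {n : ℕ} (v : Perm (Fin n)) :
    invCount v = ∑ p, ∑ q, if p < q ∧ v q < v p then 1 else 0 := by
  rw [invCount, Finset.card_filter, ← Finset.univ_product_univ, Finset.sum_product]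

theorem invCount_mul_swap {n : ℕ} (v : Perm (Fin n)) {i j : Fin n} (hij : i < j)
    (hv : v i < v j) :
    invCount (v * swap i j) = invCount v + 1
      + 2 * #{k | i < k ∧ k < j ∧ v i < v k ∧ v k < v j} := by
  have hcard : #{k | i < k ∧ k < j ∧ v i < v k ∧ v k < v j}
      = ∑ k ∈ univ \ {i, j}, if i < k ∧ k < j ∧ v i < v k ∧ v k < v j then 1 else 0 := by
    rw [Finset.card_filter]
    refine (Finset.sum_subset (Finset.subset_univ _) fun k _ hk => ?_).symm
    have : k = i ∨ k = j := by simpa [or_iff_not_imp_left] using hk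
    rcases this with rfl | rfl <;> simp
  rw [invCount_eq_sum, invCount_eq_sum, sum_sum_eq_off_pair hij.ne, sum_sum_eq_off_pair hij.ne,
    hcard, Finset.mul_sum]
  have off : ∀ k ∈ univ \ {i, j}, k ≠ i ∧ k ≠ j ∧ swap i j k = k := by
    intro k hk
    have : k ≠ i ∧ k ≠ j := by simpa using hk
    exact ⟨this.1, this.2, swap_apply_of_ne_of_ne this.1 this.2⟩
  have inner : ∑ p ∈ univ \ {i, j}, ∑ q ∈ univ \ {i, j},
        (if p < q ∧ (v * swap i j) q < (v * swap i j) p then 1 else 0)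
      = ∑ p ∈ univ \ {i, j}, ∑ q ∈ univ \ {i, j}, if p < q ∧ v q < v p then 1 else 0 := by
    refine Finset.sum_congr rfl fun p hp => Finset.sum_congr rfl fun q hq => ?_
    simp [(off p hp).2.2, (off q hq).2.2]
  have mixed : ∀ k ∈ univ \ {i, j},
      ((if k < i ∧ (v * swap i j) i < (v * swap i j) k then 1 else 0)
        + (if k < j ∧ (v * swap i j) j < (v * swap i j) k then 1 else 0)
        + (if i < k ∧ (v * swap i j) k < (v * swap i j) i then 1 else 0)
        + (if j < k ∧ (v * swap i j) k < (v * swap i j) j then 1 else 0))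
      = ((if k < i ∧ v i < v k then 1 else 0) + (if k < j ∧ v j < v k then 1 else 0)
        + (if i < k ∧ v k < v i then 1 else 0) + (if j < k ∧ v k < v j then 1 else 0))
        + 2 * (if i < k ∧ k < j ∧ v i < v k ∧ v k < v j then 1 else 0) := by
    intro k hk
    obtain ⟨hki, hkj, hk⟩ := off k hk
    have h1 : v k ≠ v i := fun h => hki (v.injective h)
    have h2 : v k ≠ v j := fun h => hkj (v.injective h)
    simp only [Perm.mul_apply, hk, swap_apply_left, swap_apply_right]
    clear hk inner off hcard
    generalize v i = a at *
    generalize v j = b at *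
    generalize v k = c at *
    rcases lt_or_gt_of_ne hki with h3 | h3 <;> rcases lt_or_gt_of_ne hkj with h4 | h4 <;>
      rcases lt_or_gt_of_ne h1 with h5 | h5 <;> rcases lt_or_gt_of_ne h2 with h6 | h6 <;>
      simp [h3, h4, h5, h6, h3.not_gt, h4.not_gt, h5.not_gt, h6.not_gt] <;> order
  rw [inner, Finset.sum_congr rfl mixed, Finset.sum_add_distrib]
  simp only [Perm.mul_apply, swap_apply_left, swap_apply_right]
  simp [hij, hv, hij.not_gt, hv.not_gt]
  ring

theorem invCount_mul_swap_eq_succ_iff {n : ℕ} (v : Perm (Fin n)) {i j : Fin n} (hij : i < j) :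
    invCount (v * swap i j) = invCount v + 1 ↔
      v i < v j ∧ ∀ k, i < k → k < j → v i < v k → ¬ v k < v j := by
  rcases lt_or_gt_of_ne (v.injective.ne hij.ne) with hv | hv
  · rw [invCount_mul_swap v hij hv]
    simp [hv, Finset.filter_eq_empty_iff]
  · have := invCount_mul_swap (v * swap i j) hij (by simpa using hv)
    rw [mul_assoc, swap_mul_self, mul_one] at this
    constructor
    · intro h; omega
    · intro h; exact absurd h.1 hv.not_gt

theorem invCount_mul_swap_adjacent {n : ℕ} (v : Perm (Fin n)) {i j : Fin n}
    (hij : (j : ℕ) = i + 1) (hv : v i < v j) : invCount (v * swap i j) = invCount v + 1 := by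
  rw [invCount_mul_swap_eq_succ_iff v (by rw [Fin.lt_def]; omega)]
  refine ⟨hv, fun k hk hk' => ?_⟩
  rw [Fin.lt_def] at hk hk'
  omega

/-- A strong Bruhat cover which does not swap the adjacent positions `i`, `j` preserves an ascent
at these positions. -/
theorem ascent_mul_swap_of_cover {n : ℕ} {u : Perm (Fin n)} {i j a b : Fin n}
    (hij : (j : ℕ) = i + 1) (hab : a < b) (hcov : invCount (u * swap a b) = invCount u + 1)
    (hne : ¬ (a = i ∧ b = j)) (hu : u i < u j) :
    (u * swap a b) i < (u * swap a b) j := by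
  obtain ⟨hlt, hbet⟩ := (invCount_mul_swap_eq_succ_iff u hab).1 hcov
  have h1 := hbet i
  have h2 := hbet j
  have h3 : u a = u i → a = i := fun h => u.injective h
  have h4 : u b = u j → b = j := fun h => u.injective h
  have h5 : u b = u i → b = i := fun h => u.injective h
  have h6 : u a = u j → a = j := fun h => u.injective h
  simp only [Perm.mul_apply, swap_apply_def]
  grind

/-- The `k`-th coordinate of the root `e_i - e_j`. -/
def rootCoord {n : ℕ} (i j k : Fin n) : ℚ := (if k = i then 1 else 0) - (if k = j then 1 else 0)

theorem rootCoord_swap {n : ℕ} (i j a b k : Fin n) :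
    rootCoord (swap i j a) (swap i j b) (swap i j k) = rootCoord a b k := by
  simp [rootCoord]

/-- The divided difference operator at the positions `i`, `j` on coefficient functions. -/
def divDiff {n : ℕ} (i j : Fin n) : Module.End ℚ (Perm (Fin n) → ℚ) where
  toFun f w := if w i < w j then f (w * swap i j) else 0
  map_add' f g := by ext w; simp only [Pi.add_apply]; split_ifs <;> simp
  map_smul' c f := by ext w; simp

/-- The Chevalley–Monk operator of the `k`-th variable on coefficient functions. -/
def monk {n : ℕ} (k : Fin n) : Module.End ℚ (Perm (Fin n) → ℚ) where
  toFun f w := ∑ p : Fin n × Fin n,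
    if p.1 < p.2 ∧ invCount w = invCount (w * swap p.1 p.2) + 1
    then rootCoord p.1 p.2 k * f (w * swap p.1 p.2) else 0
  map_add' f g := by
    ext w
    simp only [Pi.add_apply, mul_add, ← Finset.sum_add_distrib]
    refine Finset.sum_congr rfl fun p _ => ?_
    split_ifs <;> simp
  map_smul' c f := by
    ext w
    simp only [Pi.smul_apply, smul_eq_mul, RingHom.id_apply, Finset.mul_sum]
    refine Finset.sum_congr rfl fun p _ => ?_
    split_ifs <;> ring

theorem divDiff_apply {n : ℕ} (i j : Fin n) (f : Perm (Fin n) → ℚ) (w : Perm (Fin n)) :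
    divDiff i j f w = if w i < w j then f (w * swap i j) else 0 := rfl

theorem monk_apply {n : ℕ} (k : Fin n) (f : Perm (Fin n) → ℚ) (w : Perm (Fin n)) :
    monk k f w = ∑ p : Fin n × Fin n,
      if p.1 < p.2 ∧ invCount w = invCount (w * swap p.1 p.2) + 1
      then rootCoord p.1 p.2 k * f (w * swap p.1 p.2) else 0 := rfl

theorem mul_swap_ascent_iff {n : ℕ} (w : Perm (Fin n)) {i j : Fin n} (hij : i ≠ j) :
    (w * swap i j) i < (w * swap i j) j ↔ ¬ w i < w j := by
  simpa using (w.injective.ne hij).symm.le_iff_lt.symm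

theorem swap_adjacent_lt_iff {n : ℕ} {i j : Fin n} (hij : (j : ℕ) = i + 1) {a b : Fin n}
    (h1 : ¬ (a = i ∧ b = j)) (h2 : ¬ (a = j ∧ b = i)) :
    swap i j a < swap i j b ↔ a < b := by
  simp only [swap_apply_def]
  grind

theorem cover_mul_swap_adjacent_iff {n : ℕ} (w : Perm (Fin n)) {i j a b : Fin n}
    (hij : (j : ℕ) = i + 1) (hw : w i < w j) (hab : a < b) (hne : ¬ (a = i ∧ b = j)) :
    invCount (w * swap i j) = invCount (w * swap i j * swap a b) + 1 ↔
      invCount w = invCount (w * swap i j * swap a b * swap i j) + 1 ∧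
        (w * swap i j * swap a b * swap i j) i < (w * swap i j * swap a b * swap i j) j := by
  have hij' : i ≠ j := by rintro rfl; omega
  have hws := invCount_mul_swap_adjacent w hij hw
  set u := w * swap i j * swap a b * swap i j with hu
  have hus : w * swap i j * swap a b = u * swap i j := by simp [hu, mul_assoc]
  have hws' : w * swap i j = u * swap i j * swap a b := by simp [hu, mul_assoc]
  rw [hus]
  constructor
  · intro h
    have hasc : u i < u j := by
      by_contra hcon
      have h3 : (u * swap i j) i < (u * swap i j) j := (mul_swap_ascent_iff u hij').2 hcon
      have h4 := ascent_mul_swap_of_cover hij hab (by rw [← hws', h]) hne h3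
      rw [← hws', mul_swap_ascent_iff w hij'] at h4
      exact h4 hw
    have := invCount_mul_swap_adjacent u hij hasc
    exact ⟨by omega, hasc⟩
  · rintro ⟨h, hasc⟩
    have := invCount_mul_swap_adjacent u hij hasc
    omega

/-- The twisted Leibniz rule for divided differences and Chevalley–Monk operators. -/
theorem divDiff_mul_monk {n : ℕ} {i j : Fin n} (hij : (j : ℕ) = i + 1) (k : Fin n) :
    divDiff i j * monk k = monk (swap i j k) * divDiff i j + rootCoord i j k • 1 := by
  have hij' : i ≠ j := by rintro rfl; omega
  have hlt : i < j := by rw [Fin.lt_def]; omega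
  have hself (w : Perm (Fin n)) : w * swap i j * swap i j = w := by simp [mul_assoc]
  refine LinearMap.ext fun f => funext fun w => ?_
  simp only [Module.End.mul_apply, LinearMap.add_apply, LinearMap.smul_apply, Module.End.one_apply,
    Pi.add_apply, Pi.smul_apply, smul_eq_mul]
  rw [divDiff_apply, monk_apply (swap i j k)]
  by_cases hw : w i < w j
  · have hws := invCount_mul_swap_adjacent w hij hw
    rw [if_pos hw, ← ((swap i j).prodCongr (swap i j)).sum_comp, monk_apply]
    have hsing : rootCoord i j k * f w
        = ∑ p : Fin n × Fin n, if p = (i, j) then rootCoord i j k * f w else 0 := by simp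
    rw [hsing, ← Finset.sum_add_distrib]
    refine Finset.sum_congr rfl fun ⟨a, b⟩ _ => ?_
    simp only [Equiv.prodCongr_apply, Prod.map, Prod.mk.injEq]
    by_cases h1 : a = i ∧ b = j
    · obtain ⟨rfl, rfl⟩ := h1
      rw [swap_apply_left, swap_apply_right, if_pos ⟨hlt, by rw [hself, hws]⟩,
        if_neg fun h => hlt.not_gt h.1, if_pos ⟨rfl, rfl⟩, hself, zero_add]
    by_cases h2 : a = j ∧ b = i
    · obtain ⟨rfl, rfl⟩ := h2
      rw [swap_apply_left, swap_apply_right, if_neg fun h => hlt.not_gt h.1,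
        if_neg fun h => by have := h.2; omega, if_neg h1, zero_add]
    have hcov := cover_mul_swap_adjacent_iff w (a := a) (b := b) hij hw
    have hiff := swap_adjacent_lt_iff hij h1 h2
    rw [if_neg h1, add_zero, rootCoord_swap]
    have hconj : w * swap (swap i j a) (swap i j b) = w * swap i j * swap a b * swap i j := by
      rw [swap_apply_apply, swap_inv]
      simp only [mul_assoc]
    rw [hconj, divDiff_apply, hself (w * swap i j * swap a b)]
    by_cases hab : a < b
    · specialize hcov hab h1
      split_ifs <;> first | rfl | (exfalso; tauto) | simp
    · rw [if_neg fun h => hab h.1, if_neg fun h => hab (hiff.1 h.1)]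
  · rw [if_neg hw, Finset.sum_eq_single (i, j)]
    · have h3 := (mul_swap_ascent_iff w hij').2 hw
      have h4 := invCount_mul_swap_adjacent _ hij h3
      rw [hself] at h4
      rw [if_pos ⟨hlt, h4⟩, divDiff_apply, if_pos h3, hself]
      have hroot : rootCoord i j (swap i j k) = - rootCoord i j k := by
        rw [← rootCoord_swap i j, swap_apply_left, swap_apply_right, swap_apply_self]
        simp [rootCoord]
      rw [hroot]
      ring
    · rintro ⟨a, b⟩ _ hne
      rw [Ne, Prod.mk.injEq] at hne
      split_ifs with hc
      · rw [divDiff_apply, if_neg, mul_zero]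
        intro h
        refine hw ?_
        have h5 : w * swap a b * swap a b = w := by simp [mul_assoc]
        have := ascent_mul_swap_of_cover hij hc.1 (by rw [h5, hc.2]) hne h
        rwa [h5] at this
      · rfl
    · simp

theorem exists_descent {n : ℕ} {w : Perm (Fin n)} (hw : w ≠ 1) :
    ∃ i j : Fin n, (j : ℕ) = i + 1 ∧ w j < w i := by
  by_contra! h
  refine hw ?_
  cases n with
  | zero => exact Subsingleton.elim _ _
  | succ m =>
    have hmono : StrictMono w := Fin.strictMono_iff_lt_succ.2 fun i =>
      lt_of_le_of_ne (h i.castSucc i.succ (by simp)) (w.injective.ne i.castSucc_lt_succ.ne)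
    have := Subsingleton.elim (hmono.orderIsoOfSurjective _ w.surjective) (OrderIso.refl _)
    ext x
    exact congrArg Fin.val (DFunLike.congr_fun this x)

theorem invCount_one {n : ℕ} : invCount (1 : Perm (Fin n)) = 0 := by
  rw [invCount, Finset.card_eq_zero, Finset.filter_eq_empty_iff]
  exact fun p _ h => h.1.not_gt h.2

theorem monk_apply_one {n : ℕ} (k : Fin n) (f : Perm (Fin n) → ℚ) : monk k f 1 = 0 := by
  rw [monk_apply]
  refine Finset.sum_eq_zero fun p _ => if_neg fun h => ?_
  have := h.2
  rw [invCount_one] at this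
  omega

theorem monk_sub_monk_swap {n : ℕ} {i j : Fin n} (hij : i ≠ j) (k : Fin n) :
    monk k - monk (swap i j k) = rootCoord i j k • (monk i - monk j) := by
  by_cases hi : k = i
  · subst hi; simp [rootCoord, hij]
  by_cases hj : k = j
  · subst hj; simp only [rootCoord, hi, swap_apply_right, if_true, if_false]; module
  simp [rootCoord, hi, hj, swap_apply_of_ne_of_ne hi hj]

theorem divDiff_mul_commutator {n : ℕ} {i j : Fin n} (hij : (j : ℕ) = i + 1) (k l : Fin n) :
    divDiff i j * (monk k * monk l - monk l * monk k)
      = (monk (swap i j k) * monk (swap i j l) - monk (swap i j l) * monk (swap i j k))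
        * divDiff i j := by
  have hij' : i ≠ j := by rintro rfl; omega
  have key (k l : Fin n) : divDiff i j * (monk k * monk l)
      = monk (swap i j k) * monk (swap i j l) * divDiff i j
        + rootCoord i j l • monk (swap i j k) + rootCoord i j k • monk l := by
    rw [← mul_assoc, divDiff_mul_monk hij, add_mul, mul_assoc, divDiff_mul_monk hij, mul_add,
      mul_assoc]
    simp
  have hk := monk_sub_monk_swap hij' k
  have hl := monk_sub_monk_swap hij' l
  rw [sub_eq_iff_eq_add] at hk hl
  rw [mul_sub, key, key, sub_mul]
  rw [hk, hl]
  module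

theorem monk_commute {n : ℕ} (k l : Fin n) : Commute (monk k) (monk l) := by
  have key (m : ℕ) : ∀ w : Perm (Fin n), invCount w = m → ∀ (k l : Fin n) (f : Perm (Fin n) → ℚ),
      (monk k * monk l - monk l * monk k) f w = 0 := by
    induction m with
    | zero =>
      intro w hw k l f
      obtain rfl : w = 1 := by
        by_contra hne
        obtain ⟨i, j, hij, hd⟩ := exists_descent hne
        have hij' : i ≠ j := by rintro rfl; omega
        have := invCount_mul_swap_adjacent _ hij ((mul_swap_ascent_iff w hij').2 hd.not_gt)
        rw [mul_assoc, swap_mul_self, mul_one] at this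
        omega
      simp [monk_apply_one]
    | succ m ih =>
      intro w hw k l f
      have hne : w ≠ 1 := by
        rintro rfl
        rw [invCount_one] at hw
        omega
      obtain ⟨i, j, hij, hd⟩ := exists_descent hne
      have hij' : i ≠ j := by rintro rfl; omega
      have hasc := (mul_swap_ascent_iff w hij').2 hd.not_gt
      have hlen := invCount_mul_swap_adjacent _ hij hasc
      have hcomm := congrFun (LinearMap.congr_fun (divDiff_mul_commutator hij k l) f)
        (w * swap i j)
      rw [Module.End.mul_apply, Module.End.mul_apply, divDiff_apply, if_pos hasc] at hcomm
      rw [mul_assoc, swap_mul_self, mul_one] at hlen hcomm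
      rw [hcomm]
      exact ih _ (by omega) _ _ _
  rw [commute_iff_eq, ← sub_eq_zero]
  exact LinearMap.ext fun f => funext fun w => key _ w rfl k l f

open scoped IsMulCommutative in
/-- Evaluation of a polynomial at the commuting Chevalley–Monk operators. -/
noncomputable def monkEval (n : ℕ) :
    MvPolynomial (Fin n) ℚ →ₐ[ℚ] Module.End ℚ (Perm (Fin n) → ℚ) :=
  haveI := Algebra.isMulCommutative_adjoin ℚ (s := Set.range (monk (n := n))) (by
    rintro _ ⟨k, rfl⟩ _ ⟨l, rfl⟩
    exact monk_commute k l)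
  (Algebra.adjoin ℚ (Set.range (monk (n := n)))).val.comp
    (MvPolynomial.aeval fun k => ⟨monk k, Algebra.subset_adjoin ⟨k, rfl⟩⟩)

theorem monkEval_X {n : ℕ} (k : Fin n) : monkEval n (MvPolynomial.X k) = monk k := by
  simp [monkEval]

theorem divDiff_mul_monkEval {n : ℕ} {i j : Fin n} (hij : (j : ℕ) = i + 1)
    (f : MvPolynomial (Fin n) ℚ) :
    ∃ g : MvPolynomial (Fin n) ℚ,
      (MvPolynomial.X i - MvPolynomial.X j) * g = f - MvPolynomial.rename (swap i j) f ∧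
      divDiff i j * monkEval n f
        = monkEval n (MvPolynomial.rename (swap i j) f) * divDiff i j + monkEval n g := by
  have hij' : i ≠ j := by rintro rfl; omega
  induction f using MvPolynomial.induction_on with
  | C c =>
    refine ⟨0, by simp, ?_⟩
    rw [MvPolynomial.rename_C, ← MvPolynomial.algebraMap_eq, AlgHom.commutes, map_zero, add_zero]
    exact (Algebra.commutes c _).symm
  | add p q hp hq =>
    obtain ⟨g, hg, hg'⟩ := hp
    obtain ⟨h, hh, hh'⟩ := hq
    refine ⟨g + h, by rw [mul_add, hg, hh, map_add]; ring, ?_⟩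
    simp only [map_add, mul_add, hg', hh', add_mul]
    abel
  | mul_X p k hp =>
    obtain ⟨g, hg, hg'⟩ := hp
    have hroot : MvPolynomial.C (rootCoord i j k) * (MvPolynomial.X i - MvPolynomial.X j)
        = (MvPolynomial.X k - MvPolynomial.X (swap i j k) : MvPolynomial (Fin n) ℚ) := by
      by_cases hi : k = i
      · subst hi; simp [rootCoord, hij']
      by_cases hj : k = j
      · subst hj; simp [rootCoord, hi]
      simp [rootCoord, hi, hj, swap_apply_of_ne_of_ne hi hj]
    refine ⟨MvPolynomial.X (swap i j k) * g + MvPolynomial.C (rootCoord i j k) * p, ?_, ?_⟩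
    · rw [map_mul, MvPolynomial.rename_X]
      linear_combination MvPolynomial.X (swap i j k) * hg + p * hroot
    · rw [mul_comm p, map_mul, map_mul, map_add, map_mul, map_mul, map_mul, MvPolynomial.rename_X,
        monkEval_X, monkEval_X, ← mul_assoc, divDiff_mul_monk hij, add_mul, mul_assoc, hg',
        ← MvPolynomial.algebraMap_eq, AlgHom.commutes, Algebra.algebraMap_eq_smul_one, mul_add,
        mul_assoc, add_assoc]

theorem divDiff_single_one {n : ℕ} {i j : Fin n} (hij : i < j) :
    divDiff i j (Pi.single 1 1) = 0 := by
  ext w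
  rw [divDiff_apply, Pi.zero_apply]
  split_ifs with hw
  · refine Pi.single_eq_of_ne (fun h => ?_) _
    have := (mul_swap_ascent_iff w hij.ne).not.2 (not_not.2 hw)
    rw [h] at this
    exact this hij
  · rfl

/-- The coefficient of the longest element in the action of a polynomial on the identity. -/
noncomputable def topCoeff (n : ℕ) : MvPolynomial (Fin n) ℚ →ₗ[ℚ] ℚ :=
  LinearMap.proj Fin.revPerm ∘ₗ LinearMap.applyₗ (Pi.single 1 1) ∘ₗ (monkEval n).toLinearMap

theorem topCoeff_apply {n : ℕ} (f : MvPolynomial (Fin n) ℚ) :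
    topCoeff n f = monkEval n f (Pi.single 1 1) Fin.revPerm := rfl

theorem topCoeff_rename_swap {n : ℕ} {i j : Fin n} (hij : (j : ℕ) = i + 1)
    (f : MvPolynomial (Fin n) ℚ) :
    topCoeff n (MvPolynomial.rename (swap i j) f) = - topCoeff n f := by
  have hlt : i < j := by rw [Fin.lt_def]; omega
  obtain ⟨g, hg, hg'⟩ := divDiff_mul_monkEval hij (f + MvPolynomial.rename (swap i j) f)
  have hg0 : g = 0 := by
    have hinv : MvPolynomial.rename (swap i j) (MvPolynomial.rename (swap i j) f) = f := by
      rw [MvPolynomial.rename_rename]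
      have : (swap i j : Fin n → Fin n) ∘ swap i j = id := funext fun x => swap_apply_self i j x
      rw [this, MvPolynomial.rename_id_apply]
    rw [map_add, hinv, add_comm, sub_self] at hg
    refine (mul_eq_zero.1 hg).resolve_left fun h => hlt.ne ?_
    exact MvPolynomial.X_injective (sub_eq_zero.1 h)
  have key := congrFun (LinearMap.congr_fun hg' (Pi.single 1 1)) (Fin.revPerm * swap i j)
  rw [hg0, map_zero, add_zero, Module.End.mul_apply, Module.End.mul_apply, divDiff_single_one hlt,
    map_zero, divDiff_apply, if_pos (by simpa using hlt), mul_assoc, swap_mul_self, mul_one,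
    ← topCoeff_apply, map_add, Pi.zero_apply] at key
  linarith

theorem topCoeff_rename {n : ℕ} (σ : Perm (Fin n)) (f : MvPolynomial (Fin n) ℚ) :
    topCoeff n (MvPolynomial.rename σ f) = (Perm.sign σ : ℤ) * topCoeff n f := by
  cases n with
  | zero =>
    obtain rfl : σ = 1 := Subsingleton.elim _ _
    simp
  | succ m =>
    have hσ : σ ∈ Submonoid.closure (Set.range fun i : Fin m => swap i.castSucc i.succ) := by
      rw [Perm.mclosure_swap_castSucc_succ]; trivial
    induction hσ using Submonoid.closure_induction generalizing f with
    | mem τ hτ =>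
      obtain ⟨i, rfl⟩ := hτ
      rw [topCoeff_rename_swap (by simp), Perm.sign_swap i.castSucc_lt_succ.ne]
      simp
    | one => simp
    | mul τ ρ _ _ hτ hρ =>
      rw [Perm.coe_mul, ← MvPolynomial.rename_rename, hτ, hρ, map_mul]
      push_cast
      ring

theorem topCoeff_monomial_eq_zero {n : ℕ} {a : Fin n → ℕ} (ha : ¬ Function.Injective a) :
    topCoeff n (∏ i, MvPolynomial.X i ^ a i) = 0 := by
  obtain ⟨i, j, haij, hij⟩ : ∃ i j, a i = a j ∧ i ≠ j := by
    simpa [Function.Injective] using ha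
  have h := topCoeff_rename (swap i j) (∏ k, MvPolynomial.X k ^ a k)
  have hinv : MvPolynomial.rename (swap i j) (∏ k, MvPolynomial.X k ^ a k)
      = (∏ k, MvPolynomial.X k ^ a k : MvPolynomial (Fin n) ℚ) := by
    rw [map_prod, ← Equiv.prod_comp (swap i j)]
    refine Finset.prod_congr rfl fun k _ => ?_
    rw [map_pow, MvPolynomial.rename_X, swap_apply_self]
    congr 1
    rw [swap_apply_def]
    split_ifs with h1 h2
    · rw [h1, haij]
    · rw [h2, haij]
    · rfl
  rw [hinv, Perm.sign_swap hij] at h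
  push_cast at h
  linarith

/-- The permutations on the chain from the identity to the longest element which moves the maximal
values into the positions `0, 1, …` one after the other: the first `k` entries are the `k` largest
values in decreasing order, the next one is `r`, and the others are increasing. -/
def IsStaircase {n : ℕ} (k r : ℕ) (v : Perm (Fin n)) : Prop :=
  ∀ p : Fin n, (v p : ℕ) = if (p : ℕ) < k then n - 1 - p else if (p : ℕ) = k then r
    else if (p : ℕ) - k - 1 < r then p - k - 1 else p - k

theorem IsStaircase.exists_monk_single {n r : ℕ} {k : Fin n} {v : Perm (Fin n)}
    (hv : IsStaircase k r v) (hr : k + r + 1 < n) :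
    ∃ v', IsStaircase k (r + 1) v' ∧ monk k (Pi.single v 1) = Pi.single v' 1 := by
  set m : Fin n := ⟨k + r + 1, hr⟩
  have hmval : (m : ℕ) = k + r + 1 := rfl
  have hkm : k < m := by rw [Fin.lt_def]; omega
  have hvk : (v k : ℕ) = r := by rw [hv k]; simp
  have hvm : (v m : ℕ) = r + 1 := by rw [hv m]; split_ifs <;> omega
  have hself (w : Perm (Fin n)) (a b : Fin n) : w * swap a b * swap a b = w := by simp [mul_assoc]
  have hcov : invCount (v * swap k m) = invCount v + 1 := by
    rw [invCount_mul_swap_eq_succ_iff v hkm]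
    refine ⟨by rw [Fin.lt_def]; omega, fun p _ _ h => ?_⟩
    rw [Fin.lt_def] at h ⊢
    omega
  refine ⟨v * swap k m, fun p => ?_, funext fun w => ?_⟩
  · rw [Perm.mul_apply, swap_apply_def]
    by_cases h1 : p = k
    · subst h1; simp [hvm]
    by_cases h2 : p = m
    · subst h2; rw [if_neg h1, if_pos rfl, hvk]; split_ifs <;> omega
    rw [if_neg h1, if_neg h2, hv p]
    rw [Fin.ext_iff] at h1 h2
    split_ifs <;> omega
  · have hsing : (Pi.single (v * swap k m) 1 : Perm (Fin n) → ℚ) w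
        = ∑ p : Fin n × Fin n, if p = (k, m) then
            (Pi.single (v * swap k m) 1 : Perm (Fin n) → ℚ) w else 0 := by
      simp
    rw [hsing, monk_apply]
    refine Finset.sum_congr rfl fun ⟨a, b⟩ _ => ?_
    dsimp only
    by_cases hw : w * swap a b = v
    · obtain rfl : w = v * swap a b := by rw [← hw, hself]
      rw [hself, Pi.single_eq_same]
      by_cases hab : (a, b) = (k, m)
      · obtain ⟨rfl, rfl⟩ := Prod.mk.inj hab
        rw [if_pos ⟨hkm, hcov⟩, if_pos rfl, Pi.single_eq_same]
        simp [rootCoord, hkm.ne]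
      · rw [if_neg hab]
        split_ifs with hc
        · obtain ⟨hlt, hbet⟩ := (invCount_mul_swap_eq_succ_iff v hc.1).1 hc.2
          have hab' := hc.1
          rw [Fin.lt_def] at hlt hab'
          have ha : k ≠ a := by
            rintro rfl
            have hb := hv b
            have hbm : (b : ℕ) ≠ m := fun h => hab (by rw [Fin.ext h])
            have := hbet m
            simp only [Fin.lt_def] at this
            split_ifs at hb <;> omega
          have hb : k ≠ b := by
            rintro rfl
            have ha := hv a
            rw [if_pos hab'] at ha
            omega
          simp [rootCoord, ha, hb]
        · rfl
    · rw [Pi.single_eq_of_ne hw, mul_zero, ite_self]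
      split_ifs with hab
      · obtain ⟨rfl, rfl⟩ := Prod.mk.inj hab
        rw [Pi.single_eq_of_ne]
        rintro rfl
        exact hw (hself _ _ _)
      · rfl

theorem IsStaircase.exists_monk_pow_single {n r : ℕ} {k : Fin n} {v : Perm (Fin n)}
    (hv : IsStaircase k r v) (t : ℕ) (hr : k + r + t < n) :
    ∃ v', IsStaircase k (r + t) v' ∧ (monk k ^ t) (Pi.single v 1) = Pi.single v' 1 := by
  induction t with
  | zero => exact ⟨v, hv, by simp⟩
  | succ t ih =>
    obtain ⟨u, hu, hu'⟩ := ih (by omega)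
    obtain ⟨v', hv', hv''⟩ := hu.exists_monk_single (by omega)
    exact ⟨v', hv', by rw [pow_succ', Module.End.mul_apply, hu', hv'']⟩

theorem exists_staircase_monkEval {n : ℕ} (k : ℕ) (hk : k ≤ n) :
    ∃ v : Perm (Fin n), IsStaircase k 0 v ∧
      monkEval n (∏ p : Fin n with p.val < k, MvPolynomial.X p ^ (n - 1 - p)) (Pi.single 1 1)
        = Pi.single v 1 := by
  induction k with
  | zero =>
    refine ⟨1, fun p => ?_, by simp⟩
    rw [Perm.one_apply]
    split_ifs <;> omega
  | succ k ih =>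
    obtain ⟨v, hv, hv'⟩ := ih (by omega)
    set q : Fin n := ⟨k, by omega⟩
    have hqv : (q : ℕ) = k := rfl
    obtain ⟨u, hu, hu'⟩ :=
      IsStaircase.exists_monk_pow_single (k := q) (r := 0) hv (n - 1 - k) (by omega)
    refine ⟨u, fun p => ?_, ?_⟩
    · rw [hu p]
      split_ifs <;> omega
    · have hins : Finset.univ.filter (fun p : Fin n => p.val < k + 1)
          = insert q (Finset.univ.filter fun p : Fin n => p.val < k) := by
        ext p
        simp [Fin.ext_iff, hqv]
        omega
      rw [hins, Finset.prod_insert (by simp [hqv]), map_mul, Module.End.mul_apply, hv', map_pow,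
        monkEval_X, hqv, hu']

theorem topCoeff_staircase {n : ℕ} :
    topCoeff n (∏ p : Fin n, MvPolynomial.X p ^ (Fin.rev p : ℕ)) = 1 := by
  obtain ⟨v, hv, hv'⟩ := exists_staircase_monkEval n le_rfl
  obtain rfl : v = Fin.revPerm := by
    ext p
    rw [hv p, if_pos p.2, Fin.revPerm_apply, Fin.val_rev]
    omega
  have huniv : Finset.univ.filter (fun p : Fin n => p.val < n) = Finset.univ := by
    ext p
    simp
  have hexp (p : Fin n) : (Fin.rev p : ℕ) = n - 1 - p := by rw [Fin.val_rev]; omega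
  simp only [hexp]
  rw [huniv] at hv'
  rw [topCoeff_apply, hv', Pi.single_eq_same]

theorem topCoeff_staircase_perm {n : ℕ} (σ : Perm (Fin n)) :
    topCoeff n (∏ p : Fin n, MvPolynomial.X p ^ (σ⁻¹ (Fin.rev p) : ℕ)) = (Perm.sign σ : ℤ) := by
  have h := topCoeff_rename (Fin.revPerm * σ * Fin.revPerm)
    (∏ p : Fin n, MvPolynomial.X p ^ (Fin.rev p : ℕ))
  rw [topCoeff_staircase, mul_one] at h
  have hsign : Perm.sign (Fin.revPerm * σ * Fin.revPerm) = Perm.sign σ := by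
    rw [map_mul, map_mul, mul_right_comm, Int.units_mul_self, one_mul]
  rw [hsign] at h
  rw [← h]
  congr 1
  rw [map_prod, ← Equiv.prod_comp (Fin.revPerm * σ * Fin.revPerm)]
  refine Finset.prod_congr rfl fun p _ => ?_
  simp

theorem chain_sum_eq_pow_apply {n : ℕ} (wt : Perm (Fin n) → Perm (Fin n) → ℚ)
    (T : Module.End ℚ (Perm (Fin n) → ℚ))
    (hT : ∀ f w, T f w = ∑ x, if BruhatCov x w then wt x w * f x else 0)
    (m : ℕ) (v w : Perm (Fin n)) :
    ∑ c : Fin (m + 1) → Perm (Fin n) with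
        c 0 = v ∧ c (Fin.last m) = w ∧ ∀ i : Fin m, BruhatCov (c i.castSucc) (c i.succ),
      ∏ i : Fin m, wt (c i.castSucc) (c i.succ) = (T ^ m) (Pi.single v 1) w := by
  induction m generalizing w with
  | zero =>
    rw [Finset.sum_filter, ← (Equiv.funUnique (Fin 1) (Perm (Fin n))).symm.sum_comp]
    by_cases h : w = v
    · simp [h]
    · simp [h, Finset.filter_and, Finset.filter_eq']
  | succ m ih =>
    rw [pow_succ', Module.End.mul_apply, hT, Finset.sum_filter,
      ← (Fin.snocEquiv fun _ : Fin (m + 2) => Perm (Fin n)).sum_comp,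
      Fintype.sum_prod_type]
    simp only [← ih, Finset.sum_filter]
    have hcons (u : Perm (Fin n)) (c : Fin (m + 1) → Perm (Fin n)) :
        (if (Fin.snoc c u : Fin (m + 2) → Perm (Fin n)) 0 = v ∧
            (Fin.snoc c u : Fin (m + 2) → Perm (Fin n)) (Fin.last (m + 1)) = w ∧
            ∀ i : Fin (m + 1), BruhatCov ((Fin.snoc c u : Fin (m + 2) → Perm (Fin n)) i.castSucc)
              ((Fin.snoc c u : Fin (m + 2) → Perm (Fin n)) i.succ)
          then ∏ i : Fin (m + 1), wt ((Fin.snoc c u : Fin (m + 2) → Perm (Fin n)) i.castSucc)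
              ((Fin.snoc c u : Fin (m + 2) → Perm (Fin n)) i.succ) else 0)
          = if u = w then if BruhatCov (c (Fin.last m)) w then wt (c (Fin.last m)) w *
              if c 0 = v ∧ ∀ i : Fin m, BruhatCov (c i.castSucc) (c i.succ)
                then ∏ i : Fin m, wt (c i.castSucc) (c i.succ) else 0
            else 0 else 0 := by
      have h0 : (Fin.snoc c u : Fin (m + 2) → Perm (Fin n)) 0 = c 0 :=
        Fin.snoc_castSucc (α := fun _ => Perm (Fin n)) u c 0
      rw [h0]
      simp only [Fin.forall_fin_succ', Fin.prod_univ_castSucc, ← Fin.castSucc_succ, Fin.succ_last,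
        Fin.snoc_castSucc, Fin.snoc_last]
      by_cases hu : u = w
      · subst hu
        split_ifs <;> grind
      · simp [hu]
    have hlast (x : Perm (Fin n)) (c : Fin (m + 1) → Perm (Fin n)) :
        (if c 0 = v ∧ c (Fin.last m) = x ∧ ∀ i : Fin m, BruhatCov (c i.castSucc) (c i.succ)
          then ∏ i : Fin m, wt (c i.castSucc) (c i.succ) else 0)
          = if c (Fin.last m) = x then if c 0 = v ∧ ∀ i : Fin m, BruhatCov (c i.castSucc) (c i.succ)
            then ∏ i : Fin m, wt (c i.castSucc) (c i.succ) else 0 else 0 := by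
      split_ifs <;> grind
    simp only [Fin.snocEquiv_apply, hcons, hlast]
    rw [Finset.sum_comm]
    simp only [Finset.sum_ite_eq', Finset.mem_univ, if_true]
    have hpush (x : Perm (Fin n)) (g : (Fin (m + 1) → Perm (Fin n)) → ℚ) :
        (if BruhatCov x w then wt x w * ∑ c, (if c (Fin.last m) = x then g c else 0) else 0)
          = ∑ c, if c (Fin.last m) = x then if BruhatCov x w then wt x w * g c else 0 else 0 := by
      rw [Finset.mul_sum]
      split_ifs
      · simp
      · simp
    simp only [hpush]
    rw [Finset.sum_comm]
    simp

theorem sum_smul_monk_apply {n : ℕ} (f : Perm (Fin n) → ℚ) (w : Perm (Fin n)) :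
    (∑ k : Fin n, ((Fin.rev k : ℕ) : ℚ) • monk k) f w
      = ∑ x, if BruhatCov x w then (chevWt x w : ℚ) * f x else 0 := by
  have hself (u : Perm (Fin n)) (a b : Fin n) : u * swap a b * swap a b = u := by simp [mul_assoc]
  have hterm (x : Perm (Fin n)) : (if BruhatCov x w then (chevWt x w : ℚ) * f x else 0)
      = ∑ p : Fin n × Fin n, if x = w * swap p.1 p.2 then
          if p.1 < p.2 ∧ invCount w = invCount (w * swap p.1 p.2) + 1
          then ((p.2 - p.1 : ℕ) : ℚ) * f (w * swap p.1 p.2) else 0 else 0 := by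
    by_cases hx : BruhatCov x w
    · obtain ⟨_, _, _, _, hlen⟩ := id hx
      rw [if_pos hx, chevWt, Finset.sum_filter, Nat.cast_sum, Finset.sum_mul]
      refine Finset.sum_congr rfl fun p _ => ?_
      by_cases hp : x = w * swap p.1 p.2
      · have hw : w = x * swap p.1 p.2 := by rw [hp, hself]
        rw [if_pos hp, ← hp]
        simp [← hw, hlen]
      · have hw : w ≠ x * swap p.1 p.2 := fun h => hp (by rw [h, hself])
        simp [hp, hw]
    · rw [if_neg hx]
      refine (Finset.sum_eq_zero fun p _ => ?_).symm
      rw [ite_eq_right_iff]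
      rintro rfl
      exact if_neg fun h => hx ⟨p.1, p.2, h.1, (hself _ _ _).symm, h.2⟩
  have hcoef (a b : Fin n) (hab : a < b) :
      ∑ k : Fin n, ((Fin.rev k : ℕ) : ℚ) * rootCoord a b k = ((b - a : ℕ) : ℚ) := by
    simp only [rootCoord, mul_sub, Finset.sum_sub_distrib, mul_ite, mul_one, mul_zero,
      Finset.sum_ite_eq', Finset.mem_univ, if_true]
    rw [← Nat.cast_sub (by simp [Fin.val_rev]; omega), Fin.val_rev, Fin.val_rev]
    congr 1
    omega
  simp only [hterm]
  rw [Finset.sum_comm]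
  simp only [Finset.sum_ite_eq', Finset.mem_univ, if_true, LinearMap.sum_apply,
    Finset.sum_apply, LinearMap.smul_apply, Pi.smul_apply, smul_eq_mul, monk_apply, Finset.mul_sum]
  rw [Finset.sum_comm]
  refine Finset.sum_congr rfl fun p _ => ?_
  split_ifs with h
  · rw [← hcoef _ _ h.1, Finset.sum_mul]
    exact Finset.sum_congr rfl fun k _ => (mul_assoc ..).symm
  · simp

theorem sum_fin_val (n : ℕ) : ∑ i : Fin n, (i : ℕ) = n.choose 2 := by
  rw [Fin.sum_univ_eq_sum_range (fun i => i), Finset.sum_range_id, Nat.choose_two_right]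

theorem invCount_revPerm (n : ℕ) : invCount (Fin.revPerm : Perm (Fin n)) = n.choose 2 := by
  rw [invCount, Finset.card_filter, Fintype.sum_prod_type_right, ← sum_fin_val]
  refine Finset.sum_congr rfl fun j _ => ?_
  simp only [Fin.revPerm_apply, Fin.rev_lt_rev, and_self]
  rw [← Finset.card_filter, Finset.filter_gt_eq_Iio, Fin.card_Iio]

theorem lt_of_injective_of_sum_eq {n : ℕ} {a : Fin n → ℕ} (ha : Function.Injective a)
    (hsum : ∑ i, a i = n.choose 2) (i : Fin n) : a i < n := by
  set S := Finset.univ.image a with hS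
  have hSsum : ∑ x ∈ S, x = ∑ x ∈ Finset.range n, x := by
    rw [hS, Finset.sum_image fun _ _ _ _ h => ha h, hsum, Finset.sum_range_id, Nat.choose_two_right]
  have hcard : #(S \ Finset.range n) = #(Finset.range n \ S) := by
    rw [Finset.card_sdiff_comm]
    rw [hS, Finset.card_image_of_injective _ ha]
    simp
  have hsdiff : ∑ x ∈ S \ Finset.range n, x = ∑ x ∈ Finset.range n \ S, x := by
    have h1 := Finset.sum_inter_add_sum_sdiff S (Finset.range n) (fun x => x)
    have h2 := Finset.sum_inter_add_sum_sdiff (Finset.range n) S (fun x => x)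
    rw [Finset.inter_comm] at h2
    omega
  by_contra! hi
  have hmem : a i ∈ S \ Finset.range n := by simp [hS, hi]
  have hle : #(S \ Finset.range n) * n ≤ ∑ x ∈ S \ Finset.range n, x := by
    refine Finset.card_nsmul_le_sum _ _ _ fun x hx => ?_
    simpa using (Finset.mem_sdiff.1 hx).2
  have hlt : ∑ x ∈ Finset.range n \ S, x < #(Finset.range n \ S) * n := by
    have hne : (Finset.range n \ S).Nonempty := by
      rw [← Finset.card_pos, ← hcard]
      exact Finset.card_pos.2 ⟨_, hmem⟩
    rw [← smul_eq_mul, ← Finset.sum_const]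
    exact Finset.sum_lt_sum_of_nonempty hne fun x hx => by simpa using (Finset.mem_sdiff.1 hx).1
  rw [hcard] at hle
  omega

theorem det_vandermonde_fin (n : ℕ) :
    (Matrix.vandermonde fun i : Fin n => ((i : ℕ) : ℚ)).det =
      ∏ i : Fin n, ((i : ℕ).factorial : ℚ) := by
  cases n with
  | zero => simp
  | succ n =>
    rw [Matrix.det_vandermonde_id_eq_superFactorial,
      Fin.prod_univ_eq_prod_range (fun i => (i.factorial : ℚ)), ← Nat.cast_prod,
      Finset.prod_range_succ', ← Nat.prod_range_factorial_succ]
    simp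

theorem topCoeff_sum_pow (n : ℕ) :
    topCoeff n ((∑ k : Fin n, MvPolynomial.C ((Fin.rev k : ℕ) : ℚ) * MvPolynomial.X k)
      ^ n.choose 2) = ((n.choose 2).factorial : ℚ) := by
  set g : (Fin n → ℕ) → ℚ := fun a => (Nat.multinomial univ a : ℚ) *
    ((∏ k, ((Fin.rev k : ℕ) : ℚ) ^ a k) * topCoeff n (∏ k, MvPolynomial.X k ^ a k)) with hg
  have hexpand : topCoeff n ((∑ k : Fin n, MvPolynomial.C ((Fin.rev k : ℕ) : ℚ)
      * MvPolynomial.X k) ^ n.choose 2) = ∑ a ∈ Finset.piAntidiag univ (n.choose 2), g a := by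
    rw [Finset.sum_pow_eq_sum_piAntidiag, map_sum]
    refine Finset.sum_congr rfl fun a _ => ?_
    rw [hg]
    simp only [mul_pow, Finset.prod_mul_distrib, ← map_pow, ← map_prod]
    rw [← map_natCast MvPolynomial.C, ← MvPolynomial.smul_eq_C_mul, ← MvPolynomial.smul_eq_C_mul,
      map_smul, map_smul, smul_eq_mul, smul_eq_mul]
  set e : Perm (Fin n) → Fin n → ℕ := fun σ i => (σ⁻¹ (Fin.rev i) : ℕ) with he
  have hprod {M : Type} [CommMonoid M] (h : ℕ → M) (σ : Perm (Fin n)) :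
      ∏ i, h (e σ i) = ∏ i : Fin n, h i :=
    Equiv.prod_comp (σ⁻¹ * Fin.revPerm) (fun i : Fin n => h i)
  have hsum (σ : Perm (Fin n)) : ∑ i, e σ i = n.choose 2 := by
    rw [← sum_fin_val]
    exact Equiv.sum_comp (σ⁻¹ * Fin.revPerm) (fun i : Fin n => (i : ℕ))
  have hperm : ∑ σ, g (e σ) = ∑ a ∈ Finset.piAntidiag univ (n.choose 2), g a := by
    refine Finset.sum_of_injOn e ?_ ?_ ?_ fun _ _ => rfl
    · intro σ _ τ _ h
      refine inv_injective (Equiv.ext fun i => Fin.ext ?_)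
      simpa [he] using congrFun h (Fin.rev i)
    · intro σ _
      simp [Finset.mem_piAntidiag, hsum]
    · intro a ha hne
      have hinj : ¬ Function.Injective a := by
        intro hinj
        have hlt := lt_of_injective_of_sum_eq hinj (Finset.mem_piAntidiag.1 ha).1
        have hb : Function.Injective fun i => (⟨a i, hlt i⟩ : Fin n) := fun i j h =>
          hinj (Fin.mk.inj h)
        refine hne ⟨(Equiv.ofBijective _ (Finite.injective_iff_bijective.1 hb)
          * Fin.revPerm)⁻¹, by simp, funext fun i => ?_⟩
        rw [he]
        dsimp only
        rw [inv_inv, Perm.mul_apply, Fin.revPerm_apply, Fin.rev_rev, Equiv.ofBijective_apply]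
      rw [hg]
      simp [topCoeff_monomial_eq_zero hinj]
  have hfac : (∏ i : Fin n, ((i : ℕ).factorial : ℚ)) ≠ 0 :=
    Finset.prod_ne_zero_iff.2 fun i _ => Nat.cast_ne_zero.2 (Nat.factorial_ne_zero _)
  rw [hexpand, ← hperm]
  refine mul_left_cancel₀ hfac ?_
  rw [Finset.mul_sum, ← det_vandermonde_fin, mul_comm _ ((n.choose 2).factorial : ℚ),
    Matrix.det_apply, Finset.mul_sum, ← Matrix.det_apply, det_vandermonde_fin]
  refine Finset.sum_congr rfl fun σ _ => ?_
  have hspec := Nat.multinomial_spec univ (e σ)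
  rw [hsum, hprod Nat.factorial] at hspec
  have hpow : ∏ i, ((Fin.rev i : ℕ) : ℚ) ^ e σ i = ∏ i : Fin n, ((σ i : ℕ) : ℚ) ^ (i : ℕ) := by
    rw [← Equiv.prod_comp (Fin.revPerm * σ)]
    simp [he]
  have htop : topCoeff n (∏ i, MvPolynomial.X i ^ e σ i) = (Perm.sign σ : ℤ) :=
    topCoeff_staircase_perm σ
  rw [hg, ← hspec]
  simp only [hpow, htop, Matrix.vandermonde_apply, Units.smul_def,
    zsmul_eq_mul]
  push_cast
  ring

theorem chevalleyWeight_chain_count (n : ℕ) :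
    chainSum chevWt (1 : Equiv.Perm (Fin n)) Fin.revPerm = (n.choose 2).factorial := by
  apply Nat.cast_injective (R := ℚ)
  have hT : monkEval n (∑ k : Fin n, MvPolynomial.C ((Fin.rev k : ℕ) : ℚ) * MvPolynomial.X k)
      = ∑ k : Fin n, ((Fin.rev k : ℕ) : ℚ) • monk k := by
    rw [map_sum]
    refine Finset.sum_congr rfl fun k _ => ?_
    rw [← MvPolynomial.smul_eq_C_mul, map_smul, monkEval_X]
  rw [chainSum, Nat.cast_sum]
  simp only [Nat.cast_prod]
  rw [chain_sum_eq_pow_apply (fun x y => (chevWt x y : ℚ)) _ sum_smul_monk_apply,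
    invCount_revPerm, invCount_one, Nat.sub_zero, ← hT, ← map_pow, ← topCoeff_apply,
    topCoeff_sum_pow]
end

section
/- Define weights on strong Bruhat covers of S_n by wt(v ⋖ v·t_{ij}) = (j − i) + (b_{v⋖v t_{ij}} − d_{v⋖v t_{ij}})·z, where b = #{k : i<k<j, v(k)>v(j)} and d = #{k : i<k<j, v(k)<v(i)}. Then the weighted number of saturated chains from the identity to w₀ equals C(n,2)!, independently of z. -/
open Equiv Finset
open scoped Classical

open Polynomial in
/-- The weight `(j - i) + (b - d)z ∈ ℚ[z]` of a cover `v ⋖ u = v·t_{ij}`. -/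
noncomputable def wtBD {n : ℕ} (v u : Equiv.Perm (Fin n)) : Polynomial ℚ :=
  ∑ p ∈ Finset.univ.filter
      (fun p : Fin n × Fin n => p.1 < p.2 ∧ u = v * Equiv.swap p.1 p.2),
    ((((p.2 : ℕ) - (p.1 : ℕ) : ℕ) : Polynomial ℚ) +
      ((bQ v p.1 p.2 : Polynomial ℚ) - (dQ v p.1 p.2 : Polynomial ℚ)) * X)

namespace BruhatChains

variable {n : ℕ} {R : Type*} [CommRing R]

/-- The transposition of positions `a < b` takes `u` down to an element which it covers. -/
def IsDown (u : Perm (Fin n)) (a b : Fin n) : Prop :=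
  a < b ∧ u b < u a ∧ ∀ k, a < k → k < b → u k < u b ∨ u a < u k

/-- The weighted down-transposition operator on functions on permutations. -/
noncomputable def op (W : Perm (Fin n) → Fin n → Fin n → R) :
    (Perm (Fin n) → R) →ₗ[R] (Perm (Fin n) → R) where
  toFun f u := ∑ p : Fin n × Fin n,
    if IsDown u p.1 p.2 then W u p.1 p.2 * f (u * swap p.1 p.2) else 0
  map_add' f g := by
    ext u
    simp only [Pi.add_apply, ← sum_add_distrib]
    exact sum_congr rfl fun p _ => by split_ifs <;> ring
  map_smul' r f := by
    ext u
    simp only [Pi.smul_apply, smul_eq_mul, mul_sum, RingHom.id_apply]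
    exact sum_congr rfl fun p _ => by split_ifs <;> ring

/-- The divided difference operator in the basis of permutations. -/
noncomputable def divDiff (p q : Fin n) : (Perm (Fin n) → R) →ₗ[R] (Perm (Fin n) → R) where
  toFun f u := if u p < u q then f (u * swap p q) else 0
  map_add' f g := by ext u; simp only [Pi.add_apply]; split_ifs <;> simp
  map_smul' r f := by ext u; simp

lemma op_apply (W : Perm (Fin n) → Fin n → Fin n → R) (f : Perm (Fin n) → R) (u) :
    op W f u = ∑ p : Fin n × Fin n,
      if IsDown u p.1 p.2 then W u p.1 p.2 * f (u * swap p.1 p.2) else 0 := rfl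

lemma divDiff_apply (p q : Fin n) (f : Perm (Fin n) → R) (u) :
    divDiff p q f u = if u p < u q then f (u * swap p q) else 0 := rfl

lemma swap_cases (p q a : Fin n) :
    (a = p ∧ swap p q a = q) ∨ (a = q ∧ swap p q a = p) ∨
      (a ≠ p ∧ a ≠ q ∧ swap p q a = a) := by
  by_cases h : a = p
  · subst h; simp
  · by_cases h' : a = q
    · subst h'; simp
    · simp [h, h', swap_apply_of_ne_of_ne]

lemma isDown_mul_swap_iff {p q : Fin n} (hpq : (q : ℕ) = p + 1) {u : Perm (Fin n)}
    (hu : u p < u q) {a b : Fin n} (hab : ¬(a = p ∧ b = q)) :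
    IsDown (u * swap p q) a b ↔ IsDown u (swap p q a) (swap p q b) ∧
      (u * swap (swap p q a) (swap p q b)) p < (u * swap (swap p q a) (swap p q b)) q := by
  have hinj : ∀ x y, u x = u y → x = y := fun x y h => u.injective h
  have hp := swap_apply_left p q
  have hq := swap_apply_right p q
  have hk := @swap_apply_of_ne_of_ne _ _ p q
  have hcov : ∀ x : Fin n, x < q ↔ x ≤ p := fun x => by rw [Fin.lt_def, Fin.le_def]; omega
  have hcov' : ∀ x : Fin n, p < x ↔ q ≤ x := fun x => by rw [Fin.lt_def, Fin.le_def]; omega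
  have hne : p ≠ q := by rintro rfl; omega
  simp only [IsDown, Perm.coe_mul, Function.comp_apply]
  rcases swap_cases p q a with ⟨ha, ha'⟩ | ⟨ha, ha'⟩ | ⟨ha, ha2, ha'⟩ <;>
  rcases swap_cases p q b with ⟨hb, hb'⟩ | ⟨hb, hb'⟩ | ⟨hb, hb2, hb'⟩ <;>
  simp only [ha', hb'] <;> try grind
  rw [swap_apply_of_ne_of_ne ha.symm hb.symm, swap_apply_of_ne_of_ne ha2.symm hb2.symm]
  constructor
  · rintro ⟨h1, h2, h3⟩
    refine ⟨⟨h1, h2, fun k h4 h5 => ?_⟩, hu⟩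
    have := h3 (swap p q k)
    grind
  · rintro ⟨⟨h1, h2, h3⟩, -⟩
    refine ⟨h1, h2, fun k h4 h5 => ?_⟩
    have := h3 (swap p q k)
    grind

lemma divDiff_op {p q : Fin n} (hpq : (q : ℕ) = p + 1)
    {W W' : Perm (Fin n) → Fin n → Fin n → R} {κ : R}
    (h₀ : ∀ u : Perm (Fin n), u p < u q → W (u * swap p q) p q = κ)
    (h₁ : ∀ u : Perm (Fin n), u q < u p → W' u p q = -κ)
    (h₂ : ∀ (u : Perm (Fin n)) (a b : Fin n), u p < u q → IsDown (u * swap p q) a b →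
      ¬(a = p ∧ b = q) → W (u * swap p q) a b = W' u (swap p q a) (swap p q b))
    (f : Perm (Fin n) → R) :
    divDiff p q (op W f) = op W' (divDiff p q f) + κ • f := by
  have hne : p ≠ q := by rintro rfl; omega
  have hlt : p < q := by rw [Fin.lt_def]; omega
  ext u
  simp only [Pi.add_apply, Pi.smul_apply, smul_eq_mul, divDiff_apply, op_apply]
  rcases lt_or_gt_of_ne (fun h => hne (u.injective h) : u p ≠ u q) with hu | hu
  · rw [if_pos hu, ← Equiv.sum_comp ((swap p q).prodCongr (swap p q))
      (fun x => if IsDown u x.1 x.2 then _ else _), ← sub_eq_iff_eq_add', ← sum_sub_distrib]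
    rw [sum_eq_single (p, q)]
    · have h1 : IsDown (u * swap p q) p q := by
        refine ⟨hlt, by simpa using hu, fun k h1 h2 => ?_⟩
        rw [Fin.lt_def] at h1 h2; omega
      have h2 : ¬ IsDown u q p := fun h => absurd h.1 (by simpa using hlt.le)
      simp [h1, h2, h₀ u hu, mul_assoc]
    · rintro ⟨a, b⟩ - hab
      have hab' : ¬(a = p ∧ b = q) := by simpa using hab
      have hs : u * swap (swap p q a) (swap p q b) * swap p q = u * swap p q * swap a b := by
        rw [Equiv.swap_apply_apply]
        simp [mul_assoc]
      simp only [Equiv.prodCongr_apply, Prod.map_apply, hs]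
      by_cases hd : IsDown (u * swap p q) a b
      · have hd' := (isDown_mul_swap_iff hpq hu hab').1 hd
        rw [if_pos hd, if_pos hd'.1, if_pos hd'.2, h₂ u a b hu hd hab', sub_self]
      · rw [if_neg hd]
        have hd' := mt (isDown_mul_swap_iff hpq hu hab').2 hd
        rw [not_and] at hd'
        split_ifs with h1 h2
        · exact absurd h2 (hd' h1)
        · simp
        · simp
    · simp
  · rw [if_neg hu.not_gt, sum_eq_single (p, q)]
    · have h1 : IsDown u p q := by
        refine ⟨hlt, hu, fun k h1 h2 => ?_⟩
        rw [Fin.lt_def] at h1 h2; omega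
      simp [h1, hu, h₁ u hu, mul_assoc]
    · rintro ⟨a, b⟩ - hab
      have hab' : ¬(a = p ∧ b = q) := by simpa using hab
      simp only
      split_ifs with hd h2
      · exfalso
        obtain ⟨h3, h4, h5⟩ := hd
        simp only [Perm.coe_mul, Function.comp_apply] at h2
        have h6 := h5 p
        have h7 := h5 q
        have hcov : ∀ x : Fin n, x < q ↔ x ≤ p := fun x => by rw [Fin.lt_def, Fin.le_def]; omega
        have hcov' : ∀ x : Fin n, p < x ↔ q ≤ x := fun x => by rw [Fin.lt_def, Fin.le_def]; omega
        grind
      · simp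
      · rfl
    · simp

/-- For `u` obtained from `v` by exchanging positions `a` and `b`, this is
`bQ v a b - dQ v a b`. -/
def excess (u : Perm (Fin n)) (a b : Fin n) : R :=
  ∑ k : Fin n, if a < k ∧ k < b then
    (if u a < u k then 1 else 0) - (if u k < u b then 1 else 0) else 0

lemma excess_consecutive {p q : Fin n} (hpq : (q : ℕ) = p + 1) (u : Perm (Fin n)) :
    excess u p q = (0 : R) :=
  sum_eq_zero fun k _ => if_neg <| by rw [Fin.lt_def, Fin.lt_def]; omega

lemma excess_mul_swap {p q : Fin n} (hpq : (q : ℕ) = p + 1) {u : Perm (Fin n)}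
    (hu : u p < u q) {a b : Fin n} (hd : IsDown (u * swap p q) a b) (hab : ¬(a = p ∧ b = q)) :
    excess (u * swap p q) a b = (excess u (swap p q a) (swap p q b) : R) -
      ((if swap p q a = p ∨ swap p q a = q then 1 else 0) -
        (if swap p q b = p ∨ swap p q b = q then 1 else 0)) := by
  have hne : p ≠ q := by rintro rfl; omega
  have hcov : ∀ x : Fin n, x < q ↔ x ≤ p := fun x => by rw [Fin.lt_def, Fin.le_def]; omega
  have hcov' : ∀ x : Fin n, p < x ↔ q ≤ x := fun x => by rw [Fin.lt_def, Fin.le_def]; omega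
  rw [eq_sub_iff_add_eq', ← eq_sub_iff_add_eq, excess, excess,
    ← Equiv.sum_comp (swap p q) (fun k => if a < k ∧ k < b then _ else _), ← sum_sub_distrib,
    sum_eq_add p q hne]
  · obtain ⟨h1, h2, h3⟩ := hd
    have h4 := h3 p
    have h5 := h3 q
    simp only [Perm.coe_mul, Function.comp_apply, swap_apply_left, swap_apply_right] at *
    have hinj : ∀ x y, u x = u y → x = y := fun x y h => u.injective h
    rcases swap_cases p q a with ⟨ha, ha'⟩ | ⟨ha, ha'⟩ | ⟨ha, ha2, ha'⟩ <;>
    rcases swap_cases p q b with ⟨hb, hb'⟩ | ⟨hb, hb'⟩ | ⟨hb, hb2, hb'⟩ <;>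
    simp only [ha', hb'] at * <;> grind
  · rintro k - ⟨hk, hk'⟩
    simp only [Perm.coe_mul, Function.comp_apply, swap_apply_self]
    rw [swap_apply_of_ne_of_ne hk hk']
    have h1 : a < k ↔ swap p q a < k := by
      rcases swap_cases p q a with ⟨ha, ha'⟩ | ⟨ha, ha'⟩ | ⟨ha, ha2, ha'⟩ <;> grind
    have h2 : k < b ↔ k < swap p q b := by
      rcases swap_cases p q b with ⟨ha, ha'⟩ | ⟨ha, ha'⟩ | ⟨ha, ha2, ha'⟩ <;> grind
    simp only [h1, h2, sub_self]
  · simp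
  · simp

/-- The lowering operator with Chevalley weights `c a - c b`, deformed by `z * excess`. -/
noncomputable def chev (c : Fin n → R) (z : R) : (Perm (Fin n) → R) →ₗ[R] (Perm (Fin n) → R) :=
  op fun u a b => c a - c b + z * excess u a b

lemma divDiff_chev {p q : Fin n} (hpq : (q : ℕ) = p + 1) (c : Fin n → R) (z : R)
    (f : Perm (Fin n) → R) :
    divDiff p q (chev c z f) =
      chev (fun k => c (swap p q k) - z * if k = p ∨ k = q then 1 else 0) z (divDiff p q f) +
        (c p - c q) • f := by
  apply divDiff_op hpq
  · intro u _
    rw [excess_consecutive hpq]; ring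
  · intro u _
    rw [excess_consecutive hpq]; simp
  · intro u a b hu hd hab
    rw [excess_mul_swap hpq hu hd hab]
    simp only [swap_apply_self]
    ring

lemma invCount_eq_sum (v : Perm (Fin n)) :
    (invCount v : ℤ) = ∑ p : Fin n, ∑ q : Fin n, if p < q ∧ v q < v p then 1 else 0 := by
  rw [invCount, card_filter, ← Fintype.sum_prod_type']
  push_cast
  rfl

lemma invCount_mul_swap {v : Perm (Fin n)} {i j : Fin n} (hij : i < j) (hv : v i < v j) :
    invCount (v * swap i j) = invCount v + 1 +
      2 * #{k : Fin n | i < k ∧ k < j ∧ v i < v k ∧ v k < v j} := by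
  have hinj : ∀ x y, v x = v y → x = y := fun x y h => v.injective h
  let t := swap i j
  let F : Fin n → Fin n → ℤ := fun p q =>
    (if t p < t q ∧ v q < v p then 1 else 0) - (if p < q ∧ v q < v p then 1 else 0)
  have hF : ∀ p q, p ≠ i → p ≠ j → q ≠ i → q ≠ j → F p q = 0 := fun p q h1 h2 h3 h4 => by
    simp only [F, t]
    rw [swap_apply_of_ne_of_ne h1 h2, swap_apply_of_ne_of_ne h3 h4, sub_self]
  have h1 : (invCount (v * t) : ℤ) - invCount v = ∑ p, ∑ q, F p q := by
    rw [invCount_eq_sum, invCount_eq_sum, ← Equiv.sum_comp t]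
    simp only [F, sum_sub_distrib]
    congr 1
    refine sum_congr rfl fun p _ => ?_
    rw [← Equiv.sum_comp t]
    simp [t]
  have hsplit : ∀ g : Fin n → ℤ, ∑ p, g p = g i + g j + ∑ p ∈ {i, j}ᶜ, g p := fun g => by
    rw [← sum_add_sum_compl {i, j} g, sum_pair hij.ne]
  have h2 : ∑ p, ∑ q, F p q = F i i + F i j + F j i + F j j +
      ∑ k ∈ {i, j}ᶜ, (F i k + F j k + F k i + F k j) := by
    rw [hsplit, hsplit (F i), hsplit (F j)]
    have : ∑ p ∈ {i, j}ᶜ, ∑ q, F p q = ∑ p ∈ {i, j}ᶜ, (F p i + F p j) := by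
      refine sum_congr rfl fun p hp => ?_
      simp only [mem_compl, mem_insert, mem_singleton, not_or] at hp
      rw [hsplit, sum_eq_zero (s := {i, j}ᶜ), add_zero]
      intro q hq
      simp only [mem_compl, mem_insert, mem_singleton, not_or] at hq
      exact hF p q hp.1 hp.2 hq.1 hq.2
    rw [this]
    simp only [sum_add_distrib]
    ring
  have h3 : F i i + F i j + F j i + F j j = 1 := by
    simp only [F, t, swap_apply_left, swap_apply_right]
    grind
  have h4 : ∑ k ∈ {i, j}ᶜ, (F i k + F j k + F k i + F k j) =
      2 * #{k : Fin n | i < k ∧ k < j ∧ v i < v k ∧ v k < v j} := by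
    rw [card_filter]
    push_cast
    rw [hsplit]
    simp only [lt_irrefl, false_and, and_false, if_false, zero_add, mul_sum]
    refine sum_congr rfl fun k hk => ?_
    simp only [mem_compl, mem_insert, mem_singleton, not_or] at hk
    simp only [F, t, swap_apply_left, swap_apply_right, swap_apply_of_ne_of_ne hk.1 hk.2]
    grind
  have : (invCount (v * t) : ℤ) = invCount v + 1 +
      2 * #{k : Fin n | i < k ∧ k < j ∧ v i < v k ∧ v k < v j} := by linarith
  exact_mod_cast this

lemma invCount_mul_swap_lt {u : Perm (Fin n)} {p q : Fin n} (hpq : p < q) (hu : u q < u p) :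
    invCount (u * swap p q) < invCount u := by
  have := invCount_mul_swap (v := u * swap p q) hpq (by simpa using hu)
  rw [mul_assoc, swap_mul_self, mul_one] at this
  omega

lemma isDown_iff {u : Perm (Fin n)} {a b : Fin n} (hab : a < b) :
    IsDown u a b ↔ invCount u = invCount (u * swap a b) + 1 := by
  rcases lt_or_gt_of_ne (fun h => hab.ne (u.injective h) : u a ≠ u b) with hu | hu
  · have := invCount_mul_swap hab hu
    exact ⟨fun h => absurd h.2.1 hu.not_gt, fun h => by omega⟩
  · have := invCount_mul_swap (v := u * swap a b) hab (by simpa using hu)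
    rw [mul_assoc, swap_mul_self, mul_one] at this
    have hk : ∀ k, a < k → k < b → swap a b k = k := fun k h1 h2 =>
      swap_apply_of_ne_of_ne h1.ne' h2.ne
    have hinj : ∀ x y, u x = u y → x = y := fun x y h => u.injective h
    rw [this]
    simp only [Nat.add_eq_left, mul_eq_zero, card_eq_zero, filter_eq_empty_iff, mem_univ,
      true_implies, OfNat.ofNat_ne_zero, false_or, Perm.coe_mul, Function.comp_apply,
      swap_apply_left, swap_apply_right, IsDown, hab, hu, true_and]
    refine ⟨fun h k => ?_, fun h k h1 h2 => ?_⟩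
    · have := h k
      grind
    · have := @h k
      grind

lemma exists_descent {u : Perm (Fin n)} (hu : u ≠ 1) :
    ∃ p q : Fin n, (q : ℕ) = p + 1 ∧ u q < u p := by
  by_contra! h
  apply hu
  have hmono : StrictMono u := by
    cases n with
    | zero => exact fun a => a.elim0
    | succ m =>
      rw [Fin.strictMono_iff_lt_succ]
      intro i
      exact lt_of_le_of_ne (h _ _ (by simp)) (u.injective.ne i.castSucc_lt_succ.ne)
  ext x
  have := Subsingleton.elim (hmono.orderIsoOfSurjective u u.surjective) (OrderIso.refl _)
  exact congrArg Fin.val (DFunLike.congr_fun this x)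

lemma eq_zero_of_divDiff_mem (S : Set (Perm (Fin n) → R)) (h₁ : ∀ f ∈ S, f 1 = 0)
    (h₂ : ∀ f ∈ S, ∀ p q : Fin n, (q : ℕ) = p + 1 → divDiff p q f ∈ S) :
    ∀ f ∈ S, f = 0 := by
  suffices ∀ (m : ℕ) (u : Perm (Fin n)), invCount u = m → ∀ f ∈ S, f u = 0 from
    fun f hf => funext fun u => this _ u rfl f hf
  intro m
  induction m using Nat.strong_induction_on with
  | _ m ih =>
    rintro u rfl f hf
    by_cases hu : u = 1
    · exact hu ▸ h₁ f hf
    obtain ⟨p, q, hpq, h⟩ := exists_descent hu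
    have hlt : p < q := by rw [Fin.lt_def]; omega
    have := ih _ (invCount_mul_swap_lt hlt h) _ rfl _ (h₂ f hf p q hpq)
    simpa [divDiff_apply, h, mul_assoc] using this

lemma op_apply_one (W : Perm (Fin n) → Fin n → Fin n → R) (f : Perm (Fin n) → R) :
    op W f 1 = 0 :=
  sum_eq_zero fun _ _ => if_neg fun h => h.1.not_gt h.2.1

lemma op_add (W W' : Perm (Fin n) → Fin n → Fin n → R) : op (W + W') = op W + op W' := by
  refine LinearMap.ext fun f => funext fun u => ?_
  simp only [LinearMap.add_apply, Pi.add_apply, op_apply, ← sum_add_distrib]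
  exact sum_congr rfl fun p _ => by split_ifs <;> ring

lemma op_smul (r : R) (W : Perm (Fin n) → Fin n → Fin n → R) : op (r • W) = r • op W := by
  refine LinearMap.ext fun f => funext fun u => ?_
  simp only [LinearMap.smul_apply, Pi.smul_apply, smul_eq_mul, op_apply, mul_sum]
  exact sum_congr rfl fun p _ => by split_ifs <;> ring

lemma chev_add (c c' : Fin n → R) (z z' : R) :
    chev (c + c') (z + z') = chev c z + chev c' z' := by
  rw [chev, chev, chev, ← op_add]
  congr 1
  ext u a b
  change (c a + c' a) - (c b + c' b) + (z + z') * _ =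
    (c a - c b + z * _) + (c' a - c' b + z' * _)
  ring

lemma chev_smul (r : R) (c : Fin n → R) (z : R) : chev (r • c) (r * z) = r • chev c z := by
  rw [chev, chev, ← op_smul]
  congr 1
  ext u a b
  change r * c a - r * c b + r * z * _ = r * (c a - c b + z * _)
  ring

/-- Multiplication by the `k`-th variable in the basis of Schubert classes. -/
noncomputable def mulVar (k : Fin n) : (Perm (Fin n) → R) →ₗ[R] (Perm (Fin n) → R) :=
  chev (Pi.single k 1) 0

/-- The derivation `∑ k, x k ^ 2 * ∂ k` in the basis of Schubert classes. -/
noncomputable def sqDer : (Perm (Fin n) → R) →ₗ[R] (Perm (Fin n) → R) := chev 0 (-1)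

lemma chev_eq (c : Fin n → R) (z : R) : chev c z = ∑ k, c k • mulVar k - z • sqDer := by
  have h : ∀ s : Finset (Fin n), chev (∑ k ∈ s, c k • Pi.single k 1) 0 =
      ∑ k ∈ s, c k • (mulVar k : (Perm (Fin n) → R) →ₗ[R] _) := fun s => by
    induction s using Finset.induction_on with
    | empty => simpa using chev_smul 0 (0 : Fin n → R) 0
    | insert k s hk ih =>
      rw [sum_insert hk, sum_insert hk, ← ih, mulVar, ← chev_smul, ← chev_add]
      simp
  have hc : c = ∑ k, c k • Pi.single k 1 := by
    ext j
    simp [Finset.sum_apply, Pi.single_apply]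
  have hz := chev_add c 0 0 z
  have hz' := chev_smul (-z) (0 : Fin n → R) (-1)
  simp only [add_zero, zero_add, smul_zero, neg_mul_neg, mul_one] at hz hz'
  rw [← h, ← hc, sqDer, hz, hz']
  module

/-- The divided difference at `p`, `q` of the `k`-th variable. -/
def divDiffVar (p q k : Fin n) : R := (if k = p then 1 else 0) - if k = q then 1 else 0

lemma divDiff_mulVar {p q : Fin n} (hpq : (q : ℕ) = p + 1) (k : Fin n) (f : Perm (Fin n) → R) :
    divDiff p q (mulVar k f) =
      mulVar (swap p q k) (divDiff p q f) + (divDiffVar p q k : R) • f := by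
  rw [mulVar, divDiff_chev hpq, mulVar]
  have h : (fun j => (Pi.single k 1 : Fin n → R) (swap p q j) - 0 * if j = p ∨ j = q then 1 else 0) =
      Pi.single (swap p q k) 1 := by
    ext j
    simp [Pi.single_apply, swap_apply_eq_iff]
  rw [h]
  simp [divDiffVar, Pi.single_apply, eq_comm]

lemma divDiff_sqDer {p q : Fin n} (hpq : (q : ℕ) = p + 1) (f : Perm (Fin n) → R) :
    divDiff p q (sqDer f) = sqDer (divDiff p q f) +
      (mulVar p (divDiff p q f) + mulVar q (divDiff p q f)) := by
  have hne : p ≠ q := by rintro rfl; omega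
  rw [sqDer, divDiff_chev hpq, mulVar, mulVar, ← LinearMap.add_apply, ← LinearMap.add_apply,
    ← chev_add, ← chev_add]
  simp only [Pi.zero_apply, sub_self, zero_smul, add_zero]
  congr 2
  ext k
  simp only [Pi.add_apply, Pi.single_apply, Pi.zero_apply]
  split_ifs <;> simp_all

lemma divDiffVar_smul_sub {M : Type*} [AddCommGroup M] [Module R M] {p q : Fin n} (hne : p ≠ q)
    (k : Fin n) (g : Fin n → M) :
    (divDiffVar p q k : R) • (g p - g q) = g k - g (swap p q k) := by
  rcases swap_cases p q k with ⟨h, h'⟩ | ⟨h, h'⟩ | ⟨h, h2, h'⟩ <;> rw [h', divDiffVar]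
  · simp [h, hne]
  · simp [h, hne.symm]
  · simp [h, h2]

lemma divDiffVar_smul_add {M : Type*} [AddCommGroup M] [Module R M] {p q : Fin n} (hne : p ≠ q)
    (k : Fin n) (g : Fin n → M) :
    (divDiffVar p q k : R) • (g k + g (swap p q k)) = (divDiffVar p q k : R) • (g p + g q) := by
  rcases swap_cases p q k with ⟨h, h'⟩ | ⟨h, h'⟩ | ⟨h, h2, h'⟩ <;> rw [h', divDiffVar]
  · simp [h, hne]
  · simp [h, hne.symm, add_comm]
  · simp [h, h2]

lemma mulVar_comm (k l : Fin n) (f : Perm (Fin n) → R) :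
    mulVar k (mulVar l f) = mulVar l (mulVar k f) := by
  rw [← sub_eq_zero]
  refine eq_zero_of_divDiff_mem {g | ∃ k l, ∃ f : Perm (Fin n) → R,
    g = mulVar k (mulVar l f) - mulVar l (mulVar k f)} ?_ ?_ _ ⟨k, l, f, rfl⟩
  · rintro _ ⟨k, l, f, rfl⟩
    simp [mulVar, chev, op_apply_one]
  · rintro _ ⟨k, l, f, rfl⟩ p q hpq
    refine ⟨swap p q k, swap p q l, divDiff p q f, ?_⟩
    have hne : p ≠ q := by rintro rfl; omega
    have hk := divDiffVar_smul_sub (R := R) hne k (mulVar · f)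
    have hl := divDiffVar_smul_sub (R := R) hne l (mulVar · f)
    simp only [map_sub, divDiff_mulVar hpq, map_add, map_smul]
    linear_combination (norm := module) (divDiffVar p q l : R) • hk - (divDiffVar p q k : R) • hl

lemma sqDer_mulVar (k : Fin n) (f : Perm (Fin n) → R) :
    sqDer (mulVar k f) = mulVar k (sqDer f) + mulVar k (mulVar k f) := by
  rw [← sub_eq_zero]
  refine eq_zero_of_divDiff_mem {g | ∃ k, ∃ f : Perm (Fin n) → R,
    g = sqDer (mulVar k f) - (mulVar k (sqDer f) + mulVar k (mulVar k f))} ?_ ?_ _ ⟨k, f, rfl⟩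
  · rintro _ ⟨k, f, rfl⟩
    simp [mulVar, sqDer, chev, op_apply_one]
  · rintro _ ⟨k, f, rfl⟩ p q hpq
    refine ⟨swap p q k, divDiff p q f, ?_⟩
    have hne : p ≠ q := by rintro rfl; omega
    have hk := divDiffVar_smul_add (R := R) hne k (mulVar · f)
    simp only [map_sub, divDiff_mulVar hpq, divDiff_sqDer hpq, map_add, map_smul,
      mulVar_comm _ (swap p q k)]
    linear_combination (norm := module) -hk

open scoped IsMulCommutative in
open MvPolynomial in
lemma exists_polynomial_action : ∃ A : MvPolynomial (Fin n) R →ₗ[R] (Perm (Fin n) → R),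
    A 1 = Pi.single 1 1 ∧ ∀ k f, A (X k * f) = mulVar k (A f) := by
  let S : Set (Module.End R (Perm (Fin n) → R)) := Set.range mulVar
  have hS : ∀ a ∈ S, ∀ b ∈ S, a * b = b * a := by
    rintro _ ⟨k, rfl⟩ _ ⟨l, rfl⟩
    exact LinearMap.ext fun f => mulVar_comm k l f
  have := Algebra.isMulCommutative_adjoin R hS
  let φ : MvPolynomial (Fin n) R →ₐ[R] Algebra.adjoin R S :=
    aeval (S₁ := Algebra.adjoin R S) fun k => ⟨mulVar k, Algebra.subset_adjoin ⟨k, rfl⟩⟩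
  refine ⟨(LinearMap.applyₗ (Pi.single 1 1)).comp
    ((Algebra.adjoin R S).val.toLinearMap.comp φ.toLinearMap), ?_, fun k f => ?_⟩
  · simp
  · simp [φ]

/-- The class in the basis of permutations of a polynomial modulo the ideal of
positive degree symmetric polynomials. -/
noncomputable def schub : MvPolynomial (Fin n) R →ₗ[R] (Perm (Fin n) → R) :=
  exists_polynomial_action.choose

lemma schub_one : schub (1 : MvPolynomial (Fin n) R) = Pi.single 1 1 :=
  exists_polynomial_action.choose_spec.1

open MvPolynomial

lemma schub_X_mul (k : Fin n) (f : MvPolynomial (Fin n) R) :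
    schub (X k * f) = mulVar k (schub f) :=
  exists_polynomial_action.choose_spec.2 k f

lemma schub_C (r : R) : schub (C r : MvPolynomial (Fin n) R) = r • Pi.single 1 1 := by
  rw [← schub_one, ← map_smul, ← C_mul', mul_one]

lemma divDiff_schub_C {p q : Fin n} (hpq : p < q) (r : R) :
    divDiff p q (schub (C r)) = 0 := by
  ext u
  rw [divDiff_apply, schub_C, Pi.smul_apply, Pi.single_apply]
  split_ifs with h1 h2
  · rw [mul_eq_one_iff_eq_inv, swap_inv] at h2
    subst h2
    rw [swap_apply_left, swap_apply_right] at h1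
    exact absurd h1 hpq.not_gt
  · simp
  · rfl

lemma mulVar_sub_divDiff_schub {p q : Fin n} (hpq : (q : ℕ) = p + 1)
    (f : MvPolynomial (Fin n) R) :
    mulVar p (divDiff p q (schub f)) - mulVar q (divDiff p q (schub f)) =
      schub f - schub (rename (swap p q) f) := by
  have hne : p ≠ q := by rintro rfl; omega
  have hlt : p < q := by rw [Fin.lt_def]; omega
  induction f using MvPolynomial.induction_on with
  | C r => simp [divDiff_schub_C hlt]
  | add f g hf hg =>
    simp only [map_add]
    linear_combination (norm := module) hf + hg
  | mul_X f k hf =>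
    have hk := divDiffVar_smul_sub (R := R) hne k (mulVar · (schub f))
    have hf' := congrArg (mulVar (swap p q k)) hf
    rw [mul_comm f, map_mul (rename _), rename_X, schub_X_mul, schub_X_mul, divDiff_mulVar hpq]
    simp only [map_add, map_smul, map_sub, mulVar_comm _ (swap p q k)] at hf' ⊢
    linear_combination (norm := module) hf' + hk

lemma divDiff_schub_rename {p q : Fin n} (hpq : (q : ℕ) = p + 1) (f : MvPolynomial (Fin n) R) :
    divDiff p q (schub (rename (swap p q) f)) = -divDiff p q (schub f) := by
  have hne : p ≠ q := by rintro rfl; omega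
  have hlt : p < q := by rw [Fin.lt_def]; omega
  induction f using MvPolynomial.induction_on with
  | C r => simp [divDiff_schub_C hlt]
  | add f g hf hg =>
    simp only [map_add, hf, hg]
    module
  | mul_X f k hf =>
    have hk := divDiffVar_smul_sub (R := R) hne k (mulVar · (divDiff p q (schub f)))
    have hs : (divDiffVar p q (swap p q k) : R) = -divDiffVar p q k := by
      simp [divDiffVar, swap_apply_eq_iff]
    simp only [mul_comm f, map_mul (rename _), rename_X, schub_X_mul, divDiff_mulVar hpq,
      swap_apply_self, hf, map_neg, hs]
    rw [mulVar_sub_divDiff_schub hpq] at hk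
    linear_combination (norm := module) hk

lemma sqDer_schub_C (r : R) : sqDer (schub (C r : MvPolynomial (Fin n) R)) = 0 := by
  refine eq_zero_of_divDiff_mem {g | ∃ r : R, g = sqDer (schub (C r))} ?_ ?_ _ ⟨r, rfl⟩
  · rintro _ ⟨r, rfl⟩
    exact op_apply_one _ _
  · rintro _ ⟨r, rfl⟩ p q hpq
    refine ⟨0, ?_⟩
    rw [divDiff_sqDer hpq, divDiff_schub_C (by rw [Fin.lt_def]; omega)]
    simp

lemma sqDer_schub (f : MvPolynomial (Fin n) R) :
    sqDer (schub f) = schub (∑ k, X k * (X k * pderiv k f)) := by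
  induction f using MvPolynomial.induction_on with
  | C r =>
    simp [sqDer_schub_C]
  | add f g hf hg =>
    simp only [map_add, mul_add, sum_add_distrib] at hf hg ⊢
    rw [hf, hg]
  | mul_X f k hf =>
    have h : ∑ j, X j * (X j * pderiv j (f * X k)) =
        X k * ∑ j, X j * (X j * pderiv j f) + X k * (X k * f) := by
      have : ∀ j, X j * (X j * pderiv j (f * X k)) = X k * (X j * (X j * pderiv j f)) +
          if j = k then X k * (X k * f) else 0 := fun j => by
        rw [Derivation.leibniz, pderiv_X, Pi.single_apply]
        split_ifs with h1 h2 h2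
        · subst h1; simp only [smul_eq_mul]; ring
        · exact absurd h1.symm h2
        · exact absurd h2.symm h1
        · simp only [smul_eq_mul]; ring
      simp only [this, sum_add_distrib, mul_sum]
      simp
    rw [h, mul_comm f, map_add, schub_X_mul, schub_X_mul, schub_X_mul, schub_X_mul, ← hf,
      sqDer_mulVar]

/-- The differential operator on polynomials corresponding to `chev c z`. -/
noncomputable def chevPoly (c : Fin n → R) (z : R) (f : MvPolynomial (Fin n) R) :
    MvPolynomial (Fin n) R :=
  ∑ k, c k • (X k * f) - z • ∑ k, X k * (X k * pderiv k f)

lemma schub_chevPoly (c : Fin n → R) (z : R) (f : MvPolynomial (Fin n) R) :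
    schub (chevPoly c z f) = chev c z (schub f) := by
  simp only [chevPoly, map_sub, map_sum, map_smul, chev_eq, schub_X_mul, LinearMap.sub_apply,
    LinearMap.sum_apply, LinearMap.smul_apply, sqDer_schub]

lemma schub_rename_revPerm (σ : Perm (Fin n)) (f : MvPolynomial (Fin n) R) :
    schub (rename σ f) Fin.revPerm = (Perm.sign σ : ℤ) * schub f Fin.revPerm := by
  induction hm : invCount σ using Nat.strong_induction_on generalizing σ f with
  | _ m ih =>
    by_cases hσ : σ = 1
    · subst hσ
      simp [Perm.one_def]
    obtain ⟨p, q, hpq, h⟩ := exists_descent hσ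
    have hlt : p < q := by rw [Fin.lt_def]; omega
    have h1 := ih _ (hm ▸ invCount_mul_swap_lt hlt h) (σ * swap p q) (rename (swap p q) f) rfl
    have h2 : rename (σ * swap p q) (rename (swap p q) f) = rename σ f := by
      rw [rename_rename]
      congr 2
      ext x
      simp
    have h3 := congrFun (divDiff_schub_rename hpq f) (Fin.revPerm * swap p q)
    simp [divDiff_apply, hlt, mul_assoc] at h3
    rw [h2, h3] at h1
    rw [h1, Perm.sign_mul, Perm.sign_swap hlt.ne]
    simp

/-- The product of `c - z * t` over `t < m`. -/
def stepPow (z c : R) (m : ℕ) : R := ∏ t ∈ range m, (c - z * t)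

lemma coeff_chevPoly (c : Fin n → R) (z : R) (f : MvPolynomial (Fin n) R) (m : Fin n →₀ ℕ) :
    coeff m (chevPoly c z f) = ∑ k, if m k = 0 then 0 else
      (c k - z * (m k - 1 : ℕ)) * coeff (m - Finsupp.single k 1) f := by
  simp only [chevPoly, coeff_sub, coeff_sum, coeff_smul, coeff_X_mul', Finsupp.mem_support_iff,
    coeff_pderiv, smul_sum, smul_eq_mul]
  rw [← sum_sub_distrib]
  refine sum_congr rfl fun k _ => ?_
  by_cases h : m k = 0
  · simp [h]
  by_cases h' : m k = 1
  · simp [h']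
  have h₁ : m k - 1 ≠ 0 := by omega
  have h₂ : m - Finsupp.single k 1 - Finsupp.single k 1 + Finsupp.single k 1 =
      m - Finsupp.single k 1 := by
    apply tsub_add_cancel_of_le
    simp
    omega
  have h₃ : m k - 1 - 1 + 1 = m k - 1 := by omega
  have h₄ : ((m k - 1 - 1 : ℕ) : R) + 1 = (m k - 1 : ℕ) := by rw [← Nat.cast_add_one, h₃]
  simp [h, h₁, h₂, h₄]
  ring

lemma prod_factorial_mul_coeff_iterate (c : Fin n → R) (z : R) (N : ℕ) (m : Fin n →₀ ℕ) :
    (∏ k, ((m k).factorial : R)) * coeff m ((chevPoly c z)^[N] 1) =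
      if ∑ k, m k = N then N.factorial * ∏ k, stepPow z (c k) (m k) else 0 := by
  induction N generalizing m with
  | zero =>
    rw [Function.iterate_zero_apply, coeff_one]
    by_cases h : m = 0
    · subst h
      simp [stepPow]
    · rw [if_neg (Ne.symm h), if_neg, mul_zero]
      contrapose! h
      ext k
      simpa using (sum_eq_zero_iff.1 h) k (mem_univ k)
  | succ N ih =>
    rw [Function.iterate_succ_apply', coeff_chevPoly, mul_sum]
    have key : ∀ k, (∏ k, ((m k).factorial : R)) * (if m k = 0 then 0 else
        (c k - z * (m k - 1 : ℕ)) * coeff (m - Finsupp.single k 1) ((chevPoly c z)^[N] 1)) =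
        if ∑ k, m k = N + 1 then m k * (N.factorial * ∏ k, stepPow z (c k) (m k)) else 0 := by
      intro k
      by_cases h : m k = 0
      · simp [h]
      obtain ⟨r, hr⟩ := Nat.exists_eq_succ_of_ne_zero h
      have hm : m = (m - Finsupp.single k 1) + Finsupp.single k 1 := by
        rw [tsub_add_cancel_of_le]
        simp
        omega
      have hi := ih (m - Finsupp.single k 1)
      generalize m - Finsupp.single k 1 = l at *
      subst hm
      have hlk : l k = r := by simpa using hr
      have hs : ∑ j, (l + Finsupp.single k 1 : Fin n →₀ ℕ) j = ∑ j, l j + 1 := by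
        simp [sum_add_distrib, Finsupp.single_apply]
      have hf : ∏ j, (((l + Finsupp.single k 1 : Fin n →₀ ℕ) j).factorial : R) =
          (r + 1) * ∏ j, ((l j).factorial : R) := by
        rw [← mul_prod_erase _ _ (mem_univ k), ← mul_prod_erase univ (fun j => ((l j).factorial : R))
          (mem_univ k), hr, hlk, Nat.succ_eq_add_one, Nat.factorial_succ]
        push_cast
        rw [mul_assoc]
        congr 2
        refine prod_congr rfl fun j hj => ?_
        simp [(ne_of_mem_erase hj).symm]
      have hp : ∏ j, stepPow z (c j) ((l + Finsupp.single k 1 : Fin n →₀ ℕ) j) =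
          (c k - z * r) * ∏ j, stepPow z (c j) (l j) := by
        rw [← mul_prod_erase _ _ (mem_univ k), ← mul_prod_erase univ (fun j => stepPow z (c j) (l j))
          (mem_univ k), hr, hlk, Nat.succ_eq_add_one, stepPow, prod_range_succ, ← stepPow,
          mul_comm (stepPow _ _ _), mul_assoc]
        congr 2
        refine prod_congr rfl fun j hj => ?_
        simp [(ne_of_mem_erase hj).symm]
      rw [if_neg h, hs, hf, hp, hr]
      simp only [add_left_inj, Nat.succ_eq_add_one, add_tsub_cancel_right]
      rw [mul_mul_mul_comm, hi]
      split_ifs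
      · push_cast
        ring
      · simp
    rw [sum_congr rfl fun k _ => key k]
    split_ifs with h
    · rw [← sum_mul, ← Nat.cast_sum, h, Nat.factorial_succ]
      push_cast
      ring
    · simp

lemma det_stepPow [Nontrivial R] (z : R) :
    (Matrix.of fun i j : Fin n => stepPow z ((i.rev : ℕ) : R) j.rev).det =
      ∏ i : Fin n, ((i : ℕ).factorial : R) := by
  have h₁ := Matrix.det_submatrix_equiv_self Fin.revPerm
    (Matrix.of fun i j : Fin n => stepPow z ((i : ℕ) : R) j)
  have h₂ := Matrix.det_eval_matrixOfPolynomials_eq_det_vandermonde (fun i : Fin n => ((i : ℕ) : R))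
    (fun j => ∏ t ∈ range j, (Polynomial.X - Polynomial.C (z * t)))
    (fun j => by
      rw [Polynomial.natDegree_prod_of_monic _ _ fun t _ => Polynomial.monic_X_sub_C _]
      simp only [Polynomial.natDegree_X_sub_C, sum_const, card_range, smul_eq_mul, mul_one])
    (fun j => Polynomial.monic_prod_of_monic _ _ fun t _ => Polynomial.monic_X_sub_C _)
  simp only [Polynomial.eval_prod, Polynomial.eval_sub, Polynomial.eval_X, Polynomial.eval_C] at h₂
  refine h₁.trans (h₂.symm.trans ?_)
  rw [Fin.prod_univ_eq_prod_range (fun i => (i.factorial : R)) n, ← Nat.cast_prod]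
  cases n with
  | zero => simp
  | succ n => rw [Matrix.det_vandermonde_id_eq_superFactorial, Nat.prod_range_succ_factorial]

/-- The Lehmer code of a permutation. -/
def code (u : Perm (Fin n)) (i : Fin n) : ℕ := #{j | i < j ∧ u j < u i}

lemma code_mul_swap_left {p q : Fin n} (hpq : (q : ℕ) = p + 1) {u : Perm (Fin n)} (h : u q < u p) :
    code (u * swap p q) p = code u q := by
  unfold code
  congr 1
  ext j
  have hj := swap_cases p q j
  have hp := swap_apply_left p q
  simp only [mem_filter, mem_univ, true_and, Perm.mul_apply, hp]
  grind

lemma code_mul_swap_right {p q : Fin n} (hpq : (q : ℕ) = p + 1) {u : Perm (Fin n)} (h : u q < u p) :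
    code (u * swap p q) q + 1 = code u p := by
  unfold code
  rw [← card_insert_of_notMem (a := q) (by simp)]
  congr 1
  ext j
  have hj := swap_cases p q j
  have hp := swap_apply_right p q
  simp only [mem_filter, mem_univ, true_and, Perm.mul_apply, hp, mem_insert]
  grind

lemma code_mul_swap_of_ne {p q : Fin n} (hpq : (q : ℕ) = p + 1) (u : Perm (Fin n)) {i : Fin n}
    (hp : i ≠ p) (hq : i ≠ q) : code (u * swap p q) i = code u i := by
  refine card_equiv (swap p q) fun j => ?_
  have hj := swap_cases p q j
  have hi := swap_apply_of_ne_of_ne hp hq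
  simp only [mem_filter, mem_univ, true_and, Perm.mul_apply, hi]
  grind

lemma code_lt_iff {p q : Fin n} (hpq : (q : ℕ) = p + 1) (u : Perm (Fin n)) :
    code u q < code u p ↔ u q < u p := by
  constructor
  · intro h
    by_contra! h'
    refine h.not_ge (card_le_card fun j => ?_)
    simp only [mem_filter, mem_univ, true_and]
    grind
  · intro h
    refine card_lt_card ⟨fun j => ?_, fun hs => ?_⟩
    · simp only [mem_filter, mem_univ, true_and]
      grind
    · have := @hs q (by simpa [h] using Fin.lt_def.2 (by omega))
      simp at this

lemma sum_code (u : Perm (Fin n)) : ∑ i, code u i = invCount u := by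
  simp only [code, invCount, card_filter, Fintype.sum_prod_type]

lemma code_one (i : Fin n) : code 1 i = 0 := by
  simp only [code, card_eq_zero, Perm.one_apply]
  grind

lemma code_revPerm (i : Fin n) : code Fin.revPerm i = i.rev := by
  have : (univ.filter fun j : Fin n => i < j ∧ Fin.revPerm j < Fin.revPerm i) = Ioi i := by
    ext j
    simp
  rw [code, this, Fin.card_Ioi, Fin.val_rev]
  omega

/-- The exponent vector `(n - 1, …, 1, 0)`. -/
noncomputable def staircase (n : ℕ) : Fin n →₀ ℕ :=
  Finsupp.equivFunOnFinite.symm fun i => (i.rev : ℕ)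

lemma mapDomain_staircase_apply (σ : Perm (Fin n)) (i : Fin n) :
    Finsupp.mapDomain σ (staircase n) i = (σ.symm i).rev := by
  rw [Finsupp.mapDomain_equiv_apply]
  rfl

lemma mapDomain_staircase_injective :
    Function.Injective fun σ : Perm (Fin n) => Finsupp.mapDomain σ (staircase n) := by
  intro σ τ h
  refine Equiv.symm_bijective.injective (Equiv.ext fun i => ?_)
  have hi := DFunLike.congr_fun h i
  simp only [mapDomain_staircase_apply] at hi
  exact Fin.rev_injective (Fin.ext hi)

lemma image_eq_range_of_sum_eq {m : Fin n → ℕ} (hm : Function.Injective m)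
    (hs : ∑ i, m i = ∑ i ∈ range n, i) : univ.image m = range n := by
  have hcard : #(univ.image m) = #(range n) := by
    rw [card_image_of_injective _ hm, card_univ, Fintype.card_fin, card_range]
  rw [← sum_image (g := m) (f := fun x => x) hm.injOn] at hs
  generalize univ.image m = s at *
  have hc : #(s \ range n) = #(range n \ s) := by
    have h₁ := card_sdiff_add_card_inter s (range n)
    have h₂ := card_sdiff_add_card_inter (range n) s
    rw [inter_comm] at h₂
    omega
  have hsum : ∑ x ∈ s \ range n, x = ∑ x ∈ range n \ s, x := by
    have h₁ := sum_inter_add_sum_sdiff s (range n) fun x => x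
    have h₂ := sum_inter_add_sum_sdiff (range n) s fun x => x
    rw [inter_comm] at h₂
    omega
  refine eq_of_subset_of_card_le ?_ hcard.ge
  rw [← sdiff_eq_empty_iff_subset]
  by_contra! hne
  have h₁ : #(s \ range n) * n ≤ ∑ x ∈ s \ range n, x := by
    refine card_nsmul_le_sum _ _ _ fun x hx => ?_
    simpa using (mem_sdiff.1 hx).2
  have h₂ : ∑ x ∈ range n \ s, x < ∑ x ∈ range n \ s, n := by
    refine sum_lt_sum_of_nonempty ?_ fun x hx => ?_
    · rw [← card_pos, ← hc, card_pos]
      exact hne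
    · simpa using (mem_sdiff.1 hx).1
  rw [sum_const, smul_eq_mul, ← hc, ← hsum] at h₂
  omega

lemma exists_eq_mapDomain_staircase {m : Fin n →₀ ℕ} (hm : Function.Injective m)
    (hs : ∑ i, m i = ∑ i ∈ range n, i) :
    ∃ σ : Perm (Fin n), Finsupp.mapDomain σ (staircase n) = m := by
  have hlt : ∀ i, m i < n := fun i => by
    rw [← mem_range, ← image_eq_range_of_sum_eq hm hs]
    exact mem_image_of_mem _ (mem_univ i)
  have hinj : Function.Injective fun i => (⟨m i, hlt i⟩ : Fin n).rev := fun i j h =>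
    hm (Fin.ext_iff.1 (Fin.rev_injective h))
  refine ⟨(Equiv.ofBijective _ (Finite.injective_iff_bijective.1 hinj)).symm, ?_⟩
  ext i
  rw [mapDomain_staircase_apply]
  simp

section CharZero

variable [IsDomain R] [CharZero R]

lemma divDiff_schub_eq_zero {p q : Fin n} (hpq : (q : ℕ) = p + 1) {f : MvPolynomial (Fin n) R}
    (hf : rename (swap p q) f = f) : divDiff p q (schub f) = 0 := by
  have h := divDiff_schub_rename hpq f
  rw [hf] at h
  ext u
  exact self_eq_neg.1 (congrFun h u)

lemma schub_monomial_code (u : Perm (Fin n))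
    (hu : ∀ p q : Fin n, (q : ℕ) = p + 1 → code u q ≤ code u p ∧ code u p ≤ code u q + 1) :
    schub (monomial (Finsupp.equivFunOnFinite.symm (code u)) (1 : R)) u = 1 := by
  induction hm : invCount u using Nat.strong_induction_on generalizing u with
  | _ m ih =>
    by_cases h1 : u = 1
    · subst h1
      have : Finsupp.equivFunOnFinite.symm (code (1 : Perm (Fin n))) = 0 := by
        ext i
        simp [code_one]
      rw [this, monomial_zero', C_1, schub_one, Pi.single_eq_same]
    have hex : ∃ k : ℕ, ∃ p q : Fin n, (p : ℕ) = k ∧ (q : ℕ) = p + 1 ∧ u q < u p := by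
      obtain ⟨p, q, h⟩ := exists_descent h1
      exact ⟨p, p, q, rfl, h⟩
    obtain ⟨p, q, hp, hpq, h⟩ := Nat.find_spec hex
    have hmin : ∀ p' q' : Fin n, (q' : ℕ) = p' + 1 → p' < p → ¬ u q' < u p' :=
      fun p' q' h₁ h₂ h₃ => Nat.find_min hex (hp ▸ h₂) ⟨p', q', rfl, h₁, h₃⟩
    have hlt : p < q := by rw [Fin.lt_def]; omega
    have hl := code_mul_swap_left hpq h
    have hr := code_mul_swap_right hpq h
    have hne := @code_mul_swap_of_ne n p q hpq u
    have hc := (code_lt_iff hpq u).2 h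
    have huv : u = u * swap p q * swap p q := by simp [mul_assoc]
    have hvlt : (u * swap p q) p < (u * swap p q) q := by simp [h]
    have hpp := hu p q hpq
    have hind := ih _ (hm ▸ invCount_mul_swap_lt hlt h) (u * swap p q)
    generalize u * swap p q = v at *
    have hvgood : ∀ p q : Fin n, (q : ℕ) = p + 1 → code v q ≤ code v p ∧ code v p ≤ code v q + 1 := by
      intro a b hab
      have h₁ := hu a b hab
      have h₂ := hmin a b hab
      rw [← code_lt_iff hab] at h₂
      have h₃ := @hne a
      have h₄ := @hne b
      clear hne hmin hu ih hind hex hp huv h1 hm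
      by_cases h₅ : a = p
      · have : b = q := Fin.ext (by rw [hab, hpq, h₅])
        subst h₅ this
        omega
      by_cases h₆ : a = q
      · have : b ≠ p ∧ b ≠ q := by constructor <;> rintro rfl <;> omega
        have := h₄ this.1 this.2
        subst h₆
        omega
      by_cases h₇ : b = p
      · have h₈ := h₂ (by rw [Fin.lt_def]; omega)
        have := h₃ h₅ h₆
        subst h₇
        omega
      have : b ≠ q := by
        rintro rfl
        exact h₅ (Fin.ext (by omega))
      rw [h₃ h₅ h₆, h₄ h₇ this]
      exact h₁
    have hvu := hind hvgood rfl
    clear hind ih hu hvgood hmin hp hex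
    have hX : monomial (Finsupp.equivFunOnFinite.symm (code u)) (1 : R) =
        X p * monomial (Finsupp.equivFunOnFinite.symm (code v)) (1 : R) := by
      rw [X, monomial_mul, one_mul]
      congr 2
      ext i
      have hi := @hne i
      simp only [Finsupp.equivFunOnFinite_symm_apply_apply, Finsupp.add_apply, Finsupp.single_apply]
      grind
    have hsym : rename (swap p q) (monomial (Finsupp.equivFunOnFinite.symm (code v)) (1 : R)) =
        monomial (Finsupp.equivFunOnFinite.symm (code v)) (1 : R) := by
      rw [rename_monomial]
      congr 2
      ext i
      have hi := swap_cases p q i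
      rw [Finsupp.mapDomain_equiv_apply]
      simp only [Finsupp.equivFunOnFinite_symm_apply_apply, symm_swap]
      grind
    have hd := divDiff_mulVar hpq p
      (schub (monomial (Finsupp.equivFunOnFinite.symm (code v)) (1 : R)))
    rw [divDiff_schub_eq_zero hpq hsym, ← schub_X_mul, ← hX] at hd
    have hd' := congrFun hd v
    simpa [divDiff_apply, hvlt, ← huv, hvu, divDiffVar, hlt.ne] using hd'

lemma schub_monomial_eq_zero {m : Fin n →₀ ℕ} {i j : Fin n} (hij : i ≠ j) (h : m i = m j) :
    schub (monomial m (1 : R)) Fin.revPerm = 0 := by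
  have hs := schub_rename_revPerm (swap i j) (monomial m (1 : R))
  have hm : Finsupp.mapDomain (swap i j) m = m := by
    ext k
    have hk := swap_cases i j k
    rw [Finsupp.mapDomain_equiv_apply, symm_swap]
    grind
  rw [rename_monomial, hm, Perm.sign_swap hij] at hs
  refine self_eq_neg.1 (hs.trans ?_)
  simp

lemma schub_monomial_mapDomain_staircase (σ : Perm (Fin n)) :
    schub (monomial (Finsupp.mapDomain σ (staircase n)) (1 : R)) Fin.revPerm =
      (Perm.sign σ : ℤ) := by
  have h : staircase n = Finsupp.equivFunOnFinite.symm (code Fin.revPerm) := by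
    ext i
    simp [staircase, code_revPerm]
  rw [← rename_monomial, schub_rename_revPerm, h, schub_monomial_code, mul_one]
  intro p q hpq
  simp only [code_revPerm, Fin.val_rev]
  omega

lemma prod_factorial_mul_schub_iterate (c : Fin n → R) (z : R) :
    (∏ i : Fin n, ((i : ℕ).factorial : R)) *
        schub ((chevPoly c z)^[∑ i ∈ range n, i] 1) Fin.revPerm =
      (∑ i ∈ range n, i).factorial *
        (Matrix.of fun i j : Fin n => stepPow z (c i) j.rev).det := by
  set N := ∑ i ∈ range n, i with hN
  have hcoeff := prod_factorial_mul_coeff_iterate c z N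
  set P := (chevPoly c z)^[N] 1
  have hexp : schub P Fin.revPerm =
      ∑ m ∈ P.support, coeff m P * schub (monomial m (1 : R)) Fin.revPerm := by
    conv_lhs => rw [← support_sum_monomial_coeff P]
    rw [map_sum, Finset.sum_apply]
    refine sum_congr rfl fun m _ => ?_
    rw [← mul_one (coeff m P), ← smul_eq_mul, ← smul_monomial, map_smul, Pi.smul_apply]
    simp
  have hperm : schub P Fin.revPerm = ∑ σ : Perm (Fin n),
      coeff (Finsupp.mapDomain σ (staircase n)) P * (Perm.sign σ : ℤ) := by
    rw [hexp]
    simp only [← schub_monomial_mapDomain_staircase (R := R)]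
    rw [← sum_image (g := fun σ : Perm (Fin n) => Finsupp.mapDomain σ (staircase n))
      (f := fun m => coeff m P * schub (monomial m (1 : R)) Fin.revPerm)
      mapDomain_staircase_injective.injOn]
    refine sum_congr_of_eq_on_inter (fun m hm hm' => ?_) (fun m _ hm => ?_) fun _ _ _ => rfl
    · by_cases hinj : Function.Injective m
      · have hs : ∑ i, m i ≠ N := by
          intro hs
          obtain ⟨σ, hσ⟩ := exists_eq_mapDomain_staircase hinj hs
          exact hm' (mem_image.2 ⟨σ, mem_univ _, hσ⟩)
        have h := hcoeff m
        rw [if_neg hs, mul_eq_zero, or_iff_right] at h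
        · rw [h, zero_mul]
        · exact prod_ne_zero_iff.2 fun k _ => Nat.cast_ne_zero.2 (Nat.factorial_ne_zero _)
      · simp only [Function.Injective, not_forall] at hinj
        obtain ⟨i, j, h, hij⟩ := hinj
        rw [schub_monomial_eq_zero hij h, mul_zero]
    · rw [notMem_support_iff.1 hm, zero_mul]
  rw [hperm, Matrix.det_apply', mul_sum, mul_sum]
  refine sum_congr rfl fun σ _ => ?_
  have h := hcoeff (Finsupp.mapDomain σ (staircase n))
  simp only [mapDomain_staircase_apply] at h
  have h₁ : ∏ k, (((σ.symm k).rev : ℕ).factorial : R) = ∏ i : Fin n, ((i : ℕ).factorial : R) :=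
    Equiv.prod_comp (σ.symm.trans Fin.revPerm) fun i : Fin n => ((i : ℕ).factorial : R)
  have h₂ : ∑ k, ((σ.symm k).rev : ℕ) = N := by
    rw [hN, ← Fin.sum_univ_eq_sum_range (fun i => i)]
    exact Equiv.sum_comp (σ.symm.trans Fin.revPerm) fun i : Fin n => (i : ℕ)
  have h₃ : ∏ k, stepPow z (c k) (σ.symm k).rev = ∏ k, stepPow z (c (σ k)) k.rev := by
    rw [← Equiv.prod_comp σ]
    simp only [symm_apply_apply]
  rw [h₁, if_pos h₂, h₃] at h
  rw [← mul_assoc, h, mul_left_comm, mul_comm]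
  rfl

lemma chev_pow_apply_revPerm (z : R) :
    ((chev (fun i : Fin n => ((i.rev : ℕ) : R)) z ^ ∑ i ∈ range n, i) (Pi.single 1 1)) Fin.revPerm =
      ((∑ i ∈ range n, i).factorial : R) := by
  have hiter : ∀ N, (chev (fun i : Fin n => ((i.rev : ℕ) : R)) z ^ N) (Pi.single 1 1) =
      schub ((chevPoly (fun i : Fin n => ((i.rev : ℕ) : R)) z)^[N] 1) := by
    intro N
    induction N with
    | zero => simp [schub_one]
    | succ N ih => rw [pow_succ', Module.End.mul_apply, ih, Function.iterate_succ_apply',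
        schub_chevPoly]
  have h := prod_factorial_mul_schub_iterate (fun i : Fin n => ((i.rev : ℕ) : R)) z
  rw [det_stepPow, mul_comm] at h
  rw [hiter]
  exact mul_right_cancel₀
    (prod_ne_zero_iff.2 fun i _ => Nat.cast_ne_zero.2 (Nat.factorial_ne_zero _)) h

end CharZero

lemma sum_prod_chain_eq_pow {α : Type*} [Fintype α] [DecidableEq α] (K : α → α → R)
    (L : (α → R) →ₗ[R] (α → R)) (hL : ∀ f w, L f w = ∑ v, K v w * f v) (v w : α) (m : ℕ) :
    ∑ c : Fin (m + 1) → α, (if c 0 = v ∧ c (Fin.last m) = w then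
      ∏ i : Fin m, K (c i.castSucc) (c i.succ) else 0) = (L ^ m) (Pi.single v 1) w := by
  induction m generalizing w with
  | zero =>
    rw [← Equiv.sum_comp (Equiv.funUnique (Fin 1) α).symm]
    simp only [Fin.last_zero, univ_eq_empty, prod_empty, pow_zero, Module.End.one_apply,
      Pi.single_apply, Equiv.funUnique_symm_apply, uniqueElim_const]
    by_cases h : w = v
    · simp [h]
    · rw [if_neg h]
      exact sum_eq_zero fun x _ => if_neg fun hx => h (hx.2.symm.trans hx.1)
  | succ m ih =>
    rw [pow_succ', Module.End.mul_apply, hL, ← Equiv.sum_comp (Fin.snocEquiv fun _ => α),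
      Fintype.sum_prod_type_right]
    simp only [← ih, mul_sum]
    refine Eq.trans (sum_congr rfl fun c _ => ?_) sum_comm
    have h0 : ∀ x, (Fin.snoc c x : Fin (m + 2) → α) 0 = c 0 := fun x =>
      Fin.snoc_castSucc (α := fun _ => α) x c 0
    have hprod : ∀ x, ∏ i : Fin (m + 1), K ((Fin.snoc c x : Fin (m + 2) → α) i.castSucc)
        ((Fin.snoc c x : Fin (m + 2) → α) i.succ) =
          K (c (Fin.last m)) x * ∏ i : Fin m, K (c i.castSucc) (c i.succ) := by
      intro x
      rw [Fin.prod_univ_castSucc, mul_comm, Fin.succ_last, Fin.snoc_last, Fin.snoc_castSucc]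
      congr 1
      refine prod_congr rfl fun i _ => ?_
      rw [Fin.snoc_castSucc, ← Fin.castSucc_succ, Fin.snoc_castSucc]
    simp only [Fin.snocEquiv, Equiv.coe_fn_mk, h0, Fin.snoc_last, hprod]
    by_cases h : c 0 = v
    · simp [h]
    · simp [h]

lemma chainSum_eq_pow (wt : Perm (Fin n) → Perm (Fin n) → R)
    (L : (Perm (Fin n) → R) →ₗ[R] (Perm (Fin n) → R))
    (hL : ∀ f w, L f w = ∑ v, (if BruhatCov v w then wt v w else 0) * f v) (v w : Perm (Fin n)) :
    chainSum wt v w = (L ^ (invCount w - invCount v)) (Pi.single v 1) w := by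
  rw [← sum_prod_chain_eq_pow _ L hL, chainSum, sum_filter]
  refine sum_congr rfl fun c _ => ?_
  rw [prod_ite_zero, ← ite_and]
  simp only [mem_univ, true_implies, and_assoc]

lemma bruhatCov_mul_swap_iff {w : Perm (Fin n)} {a b : Fin n} (hab : a < b) :
    BruhatCov (w * swap a b) w ↔ IsDown w a b := by
  rw [isDown_iff hab]
  refine ⟨fun ⟨_, _, _, _, h⟩ => h, fun h => ⟨a, b, hab, ?_, h⟩⟩
  simp [mul_assoc]

lemma excess_eq_sub (w : Perm (Fin n)) (a b : Fin n) :
    (excess w a b : R) = bQ (w * swap a b) a b - dQ (w * swap a b) a b := by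
  simp only [excess, bQ, dQ, card_filter, Nat.cast_sum, ← sum_sub_distrib]
  refine sum_congr rfl fun k _ => ?_
  by_cases h : a < k ∧ k < b
  · simp [h, swap_apply_of_ne_of_ne h.1.ne' h.2.ne]
  · simp only [if_neg h]
    rw [if_neg (by tauto), if_neg (by tauto)]
    simp

lemma chev_X_apply (f : Perm (Fin n) → Polynomial ℚ) (w : Perm (Fin n)) :
    chev (fun i : Fin n => ((i.rev : ℕ) : Polynomial ℚ)) Polynomial.X f w =
      ∑ v, (if BruhatCov v w then wtBD v w else 0) * f v := by
  have hterm : ∀ v, (if BruhatCov v w then wtBD v w else 0) * f v =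
      ∑ p : Fin n × Fin n, if p.1 < p.2 ∧ v = w * swap p.1 p.2 then
        (if BruhatCov v w then ((((p.2 : ℕ) - (p.1 : ℕ) : ℕ) : Polynomial ℚ) +
          ((bQ v p.1 p.2 : Polynomial ℚ) - (dQ v p.1 p.2 : Polynomial ℚ)) * Polynomial.X) else 0) *
            f v else 0 := by
    intro v
    have hp : ∀ p : Fin n × Fin n, (w = v * swap p.1 p.2) ↔ (v = w * swap p.1 p.2) := fun p => by
      constructor <;> rintro rfl <;> simp [mul_assoc]
    split_ifs
    · rw [wtBD, sum_filter, sum_mul]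
      refine sum_congr rfl fun p _ => ?_
      simp only [hp p, ite_mul, zero_mul]
    · simp
  simp only [hterm]
  rw [sum_comm, chev, op_apply]
  refine sum_congr rfl fun p _ => ?_
  by_cases hab : p.1 < p.2
  · have hcast : (((p.2 : ℕ) - (p.1 : ℕ) : ℕ) : Polynomial ℚ) =
        ((p.1.rev : ℕ) : Polynomial ℚ) - ((p.2.rev : ℕ) : Polynomial ℚ) := by
      rw [eq_sub_iff_add_eq, ← Nat.cast_add]
      congr 1
      rw [Fin.lt_def] at hab
      simp only [Fin.val_rev]
      omega
    simp only [hab, true_and, sum_ite_eq', mem_univ, if_true, bruhatCov_mul_swap_iff hab,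
      excess_eq_sub, hcast, ite_mul, zero_mul, mul_comm Polynomial.X]
  · have : ¬ IsDown w p.1 p.2 := fun h => hab h.1
    simp [hab, this]

lemma invCount_one : invCount (1 : Perm (Fin n)) = 0 := by
  rw [← sum_code]
  exact sum_eq_zero fun i _ => code_one i

lemma invCount_revPerm : invCount (Fin.revPerm : Perm (Fin n)) = ∑ i ∈ range n, i := by
  rw [← sum_code, ← Fin.sum_univ_eq_sum_range fun i => i]
  simp only [code_revPerm]
  exact Equiv.sum_comp Fin.revPerm fun i : Fin n => (i : ℕ)

end BruhatChains

theorem generalized_chevalley_specialized (n : ℕ) :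
    chainSum wtBD (1 : Equiv.Perm (Fin n)) Fin.revPerm =
      ((n.choose 2).factorial : Polynomial ℚ) := by
  rw [BruhatChains.chainSum_eq_pow _ _ BruhatChains.chev_X_apply, BruhatChains.invCount_one,
    BruhatChains.invCount_revPerm, Nat.sub_zero, BruhatChains.chev_pow_apply_revPerm,
    Finset.sum_range_id, Nat.choose_two_right]
end

section
/- Monk's rule at full degree: in ℂ[x_1,...,x_n]/I (I generated by symmetric polynomials with zero constant term), for any w ∈ S_n and 1 ≤ m < n, (x_1 + ... + x_m)·𝔖_w = Σ 𝔖_{w·t_{jk}}, the sum over pairs j ≤ m < k with ℓ(w·t_{jk}) = ℓ(w) + 1. -/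
open Equiv Finset
open scoped Classical

open MvPolynomial

section Length

variable {n : ℕ}

/-- Exchanging an increasing pair of entries increases the number of inversions. -/
theorem invCount_lt_mul_swap (w : Equiv.Perm (Fin n)) {j k : Fin n} (hjk : j < k)
    (hw : w j < w k) : invCount w < invCount (w * Equiv.swap j k) := by
  unfold invCount
  set t := Equiv.swap j k with ht
  have htt : ∀ p, t (t p) = p := fun p => Equiv.swap_apply_self j k p
  have htp : ∀ p, t p = if p = j then k else if p = k then j else p :=
    fun p => Equiv.swap_apply_def j k p
  let F : Fin n × Fin n → Fin n × Fin n := fun p => if t p.1 < t p.2 then (t p.1, t p.2) else p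
  have hmem : (j, k) ∈ Finset.univ.filter
      (fun p : Fin n × Fin n => p.1 < p.2 ∧ (w * t) p.2 < (w * t) p.1) := by
    simp [hjk, hw, ht]
  rw [← Finset.card_erase_add_one hmem, Nat.lt_succ_iff]
  refine Finset.card_le_card_of_injOn F ?_ ?_
  · rintro ⟨p, q⟩ hpq
    simp only [Finset.mem_coe, Finset.mem_filter, Finset.mem_univ, true_and] at hpq
    obtain ⟨h1, h2⟩ := hpq
    simp only [Finset.mem_coe, Finset.mem_erase, Finset.mem_filter, Finset.mem_univ, true_and, F]
    rw [Equiv.Perm.mul_apply, Equiv.Perm.mul_apply]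
    have := htt p
    have := htt q
    split_ifs with h <;> grind
  · rintro ⟨p, q⟩ hpq ⟨p', q'⟩ hpq' h
    simp only [Finset.mem_coe, Finset.mem_filter, Finset.mem_univ, true_and] at hpq hpq'
    have := htt p
    have := htt q
    have := htt p'
    have := htt q'
    simp only [F] at h
    split_ifs at h <;> simp only [Prod.mk.injEq] at h ⊢ <;> grind

/-- Exchanging an increasing pair of adjacent entries adds exactly one inversion. -/
theorem invCount_mul_swap_of_lt (w : Equiv.Perm (Fin n)) {i i' : Fin n}
    (hi : (i' : ℕ) = i + 1) (hw : w i < w i') :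
    invCount (w * Equiv.swap i i') = invCount w + 1 := by
  refine le_antisymm ?_ (invCount_lt_mul_swap w (by rw [Fin.lt_def]; omega) hw)
  unfold invCount
  set t := Equiv.swap i i' with ht
  have htt : ∀ p, t (t p) = p := fun p => Equiv.swap_apply_self i i' p
  have htp : ∀ p, t p = if p = i then i' else if p = i' then i else p :=
    fun p => Equiv.swap_apply_def i i' p
  refine (Finset.card_le_card_of_injOn (t := insert (i', i) (Finset.univ.filter
    (fun p : Fin n × Fin n => p.1 < p.2 ∧ w p.2 < w p.1)))
    (fun p => (t p.1, t p.2)) ?_ ?_).trans (Finset.card_insert_le _ _)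
  · rintro ⟨p, q⟩ hpq
    simp only [Finset.mem_coe, Finset.mem_filter, Finset.mem_univ, true_and] at hpq
    simp only [Finset.mem_coe, Finset.mem_insert, Finset.mem_filter, Finset.mem_univ, true_and,
      Prod.mk.injEq]
    by_cases h : p = i ∧ q = i'
    · left; simp [h.1, h.2, ht]
    · right
      refine ⟨?_, hpq.2⟩
      rw [htp, htp]
      have := hpq.1
      grind
  · rintro ⟨p, q⟩ _ ⟨p', q'⟩ _ h
    simpa using h

theorem invCount_mul_swap_of_gt (w : Equiv.Perm (Fin n)) {i i' : Fin n}
    (hi : (i' : ℕ) = i + 1) (hw : w i' < w i) :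
    invCount w = invCount (w * Equiv.swap i i') + 1 := by
  have := invCount_mul_swap_of_lt (w * Equiv.swap i i') hi (by simpa using hw)
  simpa [mul_assoc] using this

theorem apply_lt_of_invCount_lt (w : Equiv.Perm (Fin n)) {j k : Fin n} (hjk : j < k)
    (h : invCount w < invCount (w * Equiv.swap j k)) : w j < w k := by
  by_contra hlt
  have hne : w j ≠ w k := fun h => hjk.ne (w.injective h)
  have h2 : w k < w j := lt_of_le_of_ne (not_lt.1 hlt) hne.symm
  have := invCount_lt_mul_swap (w * Equiv.swap j k) hjk (by simpa using h2)
  simp [mul_assoc] at this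
  omega

/-- A Bruhat cover has no intermediate entry in an intermediate position. -/
theorem not_between_of_cover (w : Equiv.Perm (Fin n)) {j k p : Fin n} (hjp : j < p) (hpk : p < k)
    (h : invCount (w * Equiv.swap j k) = invCount w + 1) : ¬ (w j < w p ∧ w p < w k) := by
  rintro ⟨h1, h2⟩
  have hjk := hjp.trans hpk
  have e : w * Equiv.swap j k =
      w * Equiv.swap j p * Equiv.swap p k * Equiv.swap j p := by
    rw [mul_assoc, mul_assoc]
    congr 1
    ext x
    simp only [Equiv.Perm.mul_apply, Equiv.swap_apply_def]
    grind
  have a1 := invCount_lt_mul_swap w hjp h1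
  have a2 := invCount_lt_mul_swap (w * Equiv.swap j p) hpk (by
    simp only [Equiv.Perm.mul_apply, Equiv.swap_apply_def]; grind)
  have a3 := invCount_lt_mul_swap (w * Equiv.swap j p * Equiv.swap p k) hjp (by
    simp only [Equiv.Perm.mul_apply, Equiv.swap_apply_def]; grind)
  rw [← e] at a3
  omega

/-- If a Bruhat cover `w < w * (j k)` turns an ascent at `i` into a descent, then `(j k)` is
the adjacent transposition at `i`. -/
theorem eq_of_cover_of_ascent_of_descent (w : Equiv.Perm (Fin n)) {i i' j k : Fin n}
    (hi : (i' : ℕ) = i + 1) (hjk : j < k)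
    (h : invCount (w * Equiv.swap j k) = invCount w + 1) (hw : w i < w i')
    (hd : (w * Equiv.swap j k) i' < (w * Equiv.swap j k) i) : j = i ∧ k = i' := by
  have hlt := apply_lt_of_invCount_lt w hjk (by omega)
  have hb := fun p (h1 : j < p) (h2 : p < k) => not_between_of_cover w h1 h2 h
  have hb1 := hb i
  have hb2 := hb i'
  clear hb h
  simp only [Equiv.Perm.mul_apply, Equiv.swap_apply_def] at hd
  rw [Fin.lt_def] at *
  grind

/-- A permutation other than the longest one has an ascent. -/
theorem exists_ascent (w : Equiv.Perm (Fin n)) (hw : w ≠ Fin.revPerm) :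
    ∃ i i' : Fin n, (i' : ℕ) = i + 1 ∧ w i < w i' := by
  by_contra! hcon
  apply hw
  cases n with
  | zero => exact Subsingleton.elim _ _
  | succ n =>
    have hanti : StrictAnti w := by
      rw [Fin.strictAnti_iff_succ_lt]
      intro i
      refine lt_of_le_of_ne (hcon i.castSucc i.succ (by simp)) ?_
      intro h
      exact (Fin.castSucc_lt_succ (i := i)).ne' (w.injective h)
    have hmono : StrictMono (fun x => Fin.rev (w x)) :=
      fun a b hab => Fin.rev_lt_rev.2 (hanti hab)
    have := (StrictMono.range_inj hmono strictMono_id).1 (by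
      rw [Set.range_id, Set.range_eq_univ]
      exact Fin.rev_surjective.comp w.surjective)
    ext x
    have hx := congrFun this x
    simp only [id] at hx
    rw [Fin.revPerm_apply, ← hx, Fin.rev_rev, hx]

theorem invCount_le (w : Equiv.Perm (Fin n)) :
    invCount w ≤ invCount (Fin.revPerm : Equiv.Perm (Fin n)) := by
  unfold invCount
  refine Finset.card_le_card fun p hp => ?_
  simp only [Finset.mem_filter, Finset.mem_univ, true_and] at hp ⊢
  exact ⟨hp.1, by simpa using hp.1⟩

end Length

section DividedDifference

variable {n : ℕ}

theorem X_sub_X_dvd_sub_rename_swap {σ R : Type*} [CommRing R] [DecidableEq σ] (i j : σ)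
    (f : MvPolynomial σ R) :
    (X i - X j : MvPolynomial σ R) ∣ f - rename (Equiv.swap i j) f := by
  induction f using MvPolynomial.induction_on with
  | C a => simp
  | add p q hp hq =>
    rw [map_add, add_sub_add_comm]
    exact dvd_add hp hq
  | mul_X p k hp =>
    have hX : (X i - X j : MvPolynomial σ R) ∣ X k - X (Equiv.swap i j k) := by
      rw [Equiv.swap_apply_def]
      split_ifs with h1 h2
      · rw [h1]
      · rw [h2, ← neg_sub (X i : MvPolynomial σ R), dvd_neg]
      · simp
    have : p * X k - rename (Equiv.swap i j) (p * X k) =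
        (p - rename (Equiv.swap i j) p) * X k +
          rename (Equiv.swap i j) p * (X k - X (Equiv.swap i j k)) := by
      rw [map_mul, rename_X]; ring
    rw [this]
    exact dvd_add (hp.mul_right _) (hX.mul_left _)

/-- The ideal generated by the symmetric polynomials without constant term is stable under
divided differences. -/
theorem mem_coinvariantIdeal_of_dividedDifference {σ R : Type*} [CommRing R] [IsDomain R]
    [DecidableEq σ] {i j : σ} (hij : i ≠ j) {f g : MvPolynomial σ R}
    (hf : f ∈ Ideal.span {q : MvPolynomial σ R | q.IsSymmetric ∧ constantCoeff q = 0})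
    (hfg : (X i - X j) * g = f - rename (Equiv.swap i j) f) :
    g ∈ Ideal.span {q : MvPolynomial σ R | q.IsSymmetric ∧ constantCoeff q = 0} := by
  obtain ⟨g', hg', h⟩ :
      ∃ g' ∈ Ideal.span {q : MvPolynomial σ R | q.IsSymmetric ∧ constantCoeff q = 0},
        (X i - X j) * g' = f - rename (Equiv.swap i j) f := by
    clear hfg
    refine Submodule.span_induction (p := fun f _ =>
      ∃ g' ∈ Ideal.span {q : MvPolynomial σ R | q.IsSymmetric ∧ constantCoeff q = 0},
        (X i - X j) * g' = f - rename (Equiv.swap i j) f) ?_ ?_ ?_ ?_ hf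
    · intro q hq
      exact ⟨0, zero_mem _, by rw [hq.1, mul_zero, sub_self]⟩
    · exact ⟨0, zero_mem _, by simp⟩
    · rintro a b _ _ ⟨a', ha', ha⟩ ⟨b', hb', hb⟩
      exact ⟨a' + b', add_mem ha' hb', by rw [mul_add, ha, hb, map_add]; ring⟩
    · rintro a b hb ⟨b', hb', h⟩
      obtain ⟨c, hc⟩ := X_sub_X_dvd_sub_rename_swap i j a
      refine ⟨c * b + rename (Equiv.swap i j) a * b',
        add_mem (Ideal.mul_mem_left _ _ hb) (Ideal.mul_mem_left _ _ hb'), ?_⟩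
      rw [smul_eq_mul, map_mul]
      linear_combination (-b) * hc + rename (Equiv.swap i j) a * h
  have hne : (X i - X j : MvPolynomial σ R) ≠ 0 :=
    sub_ne_zero.2 fun h => hij (X_injective h)
  rw [mul_left_cancel₀ hne (hfg.trans h.symm)]
  exact hg'

end DividedDifference

section TopDegree

variable {n : ℕ}

theorem X_pow_mem_coinvariantIdeal_sup {R : Type*} [CommRing R] (k : Fin n) :
    (X k ^ (n - k) : MvPolynomial (Fin n) R) ∈
      Ideal.span {q : MvPolynomial (Fin n) R | q.IsSymmetric ∧ constantCoeff q = 0} ⊔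
        Ideal.span (X '' {j : Fin n | j < k}) := by
  set J := Ideal.span {q : MvPolynomial (Fin n) R | q.IsSymmetric ∧ constantCoeff q = 0} ⊔
    Ideal.span (X '' {j : Fin n | j < k}) with hJ
  let φ := Ideal.Quotient.mk J
  have hsymm : ∀ j ∈ Finset.range (n + 1), j ≠ 0 →
      φ (esymm (Fin n) R j) = 0 := by
    intro j _ hj
    refine Ideal.Quotient.eq_zero_iff_mem.2 (Ideal.mem_sup_left (Ideal.subset_span ⟨?_, ?_⟩))
    · exact esymm_isSymmetric _ _ _
    · rw [esymm, map_sum]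
      refine Finset.sum_eq_zero fun t ht => ?_
      rw [map_prod]
      have : t.Nonempty := by
        rw [← Finset.card_pos, (Finset.mem_powersetCard.1 ht).2]; omega
      obtain ⟨a, ha⟩ := this
      exact Finset.prod_eq_zero ha (by simp)
  have hlow : ∀ j : Fin n, j < k → φ (X j) = 0 := fun j hj =>
    Ideal.Quotient.eq_zero_iff_mem.2 (Ideal.mem_sup_right (Ideal.subset_span ⟨j, hj, rfl⟩))
  have hprod : ∏ i : Fin n, (Polynomial.X + Polynomial.C (φ (X i))) = Polynomial.X ^ n := by
    have := congrArg (Polynomial.map φ) (prod_C_add_X_eq_sum_esymm R (Fin n))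
    rw [Polynomial.map_prod, Polynomial.map_sum, Fintype.card_fin,
      Finset.sum_eq_single_of_mem 0 (by simp)] at this
    · simpa using this
    · intro j hj hj0
      rw [Polynomial.map_mul, Polynomial.map_C, hsymm j hj hj0]
      simp
  rw [← Finset.prod_filter_mul_prod_filter_not _ (fun i => i < k),
    Finset.prod_congr rfl (g := fun _ => Polynomial.X), Finset.prod_const] at hprod
  · have hcard : (Finset.univ.filter (fun i : Fin n => i < k)).card = k := by
      rw [Finset.filter_gt_eq_Iio, Fin.card_Iio]
    have hn : n = k + (n - k) := by omega
    rw [hcard, show (Polynomial.X ^ n : Polynomial (MvPolynomial (Fin n) R ⧸ J)) =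
      Polynomial.X ^ (k : ℕ) * Polynomial.X ^ (n - k) by rw [← pow_add, ← hn]] at hprod
    have := congrArg (Polynomial.eval (- φ (X k)))
      ((Polynomial.monic_X_pow (k : ℕ)).isRegular.left hprod)
    rw [Polynomial.eval_prod, Finset.prod_eq_zero (i := k) (by simp) (by simp)] at this
    rw [Polynomial.eval_pow, Polynomial.eval_X, neg_pow, eq_comm] at this
    rw [← Ideal.Quotient.eq_zero_iff_mem, map_pow]
    have h2 := congrArg ((-1) ^ (n - k) * ·) this
    simpa only [mul_zero, ← mul_assoc, ← mul_pow, neg_mul_neg, mul_neg_one, neg_neg, one_mul] using h2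
  · intro i hi
    rw [hlow i (Finset.mem_filter.1 hi).2]
    simp

theorem staircase_mul_X_mem {R : Type*} [CommRing R] (j : Fin n) :
    (∏ i : Fin n, X i ^ (n - 1 - (i : ℕ))) * X j ∈
      Ideal.span {q : MvPolynomial (Fin n) R | q.IsSymmetric ∧ constantCoeff q = 0} := by
  set I := Ideal.span {q : MvPolynomial (Fin n) R | q.IsSymmetric ∧ constantCoeff q = 0} with hI
  suffices H : ∀ k ≤ n, ∀ j : Fin n, (j : ℕ) < k →
      (∏ i ∈ Finset.univ.filter (fun i : Fin n => (i : ℕ) < k), X i ^ (n - 1 - (i : ℕ))) * X j ∈ I by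
    simpa using H n le_rfl j j.2
  intro k
  induction k with
  | zero => intro _ j hj; omega
  | succ k ih =>
    intro hk j hj
    have hf : Finset.univ.filter (fun i : Fin n => (i : ℕ) < k + 1) =
        insert ⟨k, hk⟩ (Finset.univ.filter (fun i : Fin n => (i : ℕ) < k)) := by
      ext i
      simp only [Finset.mem_filter, Finset.mem_univ, true_and, Finset.mem_insert, Fin.ext_iff]
      omega
    rw [hf, Finset.prod_insert (by simp), mul_assoc]
    rcases Nat.lt_succ_iff_lt_or_eq.1 hj with hj | hj
    · exact Ideal.mul_mem_left _ _ (ih (by omega) j hj)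
    · obtain rfl : j = ⟨k, hk⟩ := Fin.ext hj
      set P := ∏ i ∈ Finset.univ.filter (fun i : Fin n => (i : ℕ) < k),
        (X i ^ (n - 1 - (i : ℕ)) : MvPolynomial (Fin n) R) with hP
      have hle : I ⊔ Ideal.span (X '' {j : Fin n | j < ⟨k, hk⟩}) ≤
          Submodule.comap (LinearMap.mulLeft (MvPolynomial (Fin n) R) P) I := by
        refine sup_le (fun f hf => Ideal.mul_mem_left _ _ hf) (Ideal.span_le.2 ?_)
        rintro _ ⟨j, hj, rfl⟩
        exact ih (by omega) j hj
      have := hle (X_pow_mem_coinvariantIdeal_sup ⟨k, hk⟩)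
      rw [Submodule.mem_comap, LinearMap.mulLeft_apply] at this
      convert this using 1
      rw [mul_left_comm, ← pow_succ]
      congr 2
      show n - 1 - k + 1 = n - k
      omega

end TopDegree

section Chevalley

variable {n : ℕ}

/-- The signed summand of index `j` in the expansion of `X k * S w`. -/
noncomputable def chevalleyTerm (S : Equiv.Perm (Fin n) → MvPolynomial (Fin n) ℂ)
    (w : Equiv.Perm (Fin n)) (j k : Fin n) : MvPolynomial (Fin n) ℂ :=
  if invCount (w * Equiv.swap j k) = invCount w + 1 then
    (if k < j then 1 else -1) * S (w * Equiv.swap j k) else 0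

/-- The recursion of Schubert polynomials by divided differences. -/
def IsDividedDifferenceFamily (S : Equiv.Perm (Fin n) → MvPolynomial (Fin n) ℂ) : Prop :=
  ∀ (w : Equiv.Perm (Fin n)) (i i' : Fin n), (i' : ℕ) = i + 1 → w i' < w i →
    (X i - X i') * S (w * Equiv.swap i i') = S w - rename (Equiv.swap i i') (S w)

variable {S : Equiv.Perm (Fin n) → MvPolynomial (Fin n) ℂ}

theorem IsDividedDifferenceFamily.rename_eq (hS : IsDividedDifferenceFamily S)
    {w : Equiv.Perm (Fin n)} {i i' : Fin n} (hi : (i' : ℕ) = i + 1) (hw : w i < w i') :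
    rename (Equiv.swap i i') (S w) = S w := by
  have h1 := hS (w * Equiv.swap i i') i i' hi (by simpa using hw)
  rw [mul_assoc, Equiv.swap_mul_self, mul_one] at h1
  have h2 := congrArg (rename (Equiv.swap i i')) h1
  have h3 : rename (Equiv.swap i i') (rename (Equiv.swap i i') (S (w * Equiv.swap i i'))) =
      S (w * Equiv.swap i i') := by
    rw [rename_rename,
      show ⇑(Equiv.swap i i') ∘ ⇑(Equiv.swap i i') = id by ext; simp, rename_id_apply]
  rw [map_mul, map_sub, map_sub, rename_X, rename_X, Equiv.swap_apply_left,
    Equiv.swap_apply_right, h3] at h2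
  have hne : (X i - X i' : MvPolynomial (Fin n) ℂ) ≠ 0 :=
    sub_ne_zero.2 fun h => by
      have := X_injective h
      rw [this] at hi; omega
  refine mul_left_cancel₀ hne ?_
  linear_combination -h1 - h2

theorem mul_swap_self {α : Type*} [DecidableEq α] (w : Equiv.Perm α) (j : α) :
    w * Equiv.swap j j = w := by
  rw [Equiv.swap_self]
  rfl

theorem chevalleyTerm_self (w : Equiv.Perm (Fin n)) (j : Fin n) : chevalleyTerm S w j j = 0 := by
  rw [chevalleyTerm, mul_swap_self, if_neg (by omega)]

theorem chevalleyTerm_antisymm (w : Equiv.Perm (Fin n)) (j k : Fin n) :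
    chevalleyTerm S w j k = - chevalleyTerm S w k j := by
  rcases lt_trichotomy j k with h | rfl | h
  · unfold chevalleyTerm
    rw [Equiv.swap_comm k j, if_neg h.not_gt, if_pos h]
    split_ifs <;> simp
  · rw [chevalleyTerm_self, neg_zero]
  · unfold chevalleyTerm
    rw [Equiv.swap_comm k j, if_neg h.not_gt, if_pos h]
    split_ifs <;> simp

theorem eq_or_eq_of_cover_of_ascent_of_descent (w : Equiv.Perm (Fin n)) {i i' j k : Fin n}
    (hi : (i' : ℕ) = i + 1)
    (h : invCount (w * Equiv.swap j k) = invCount w + 1) (hw : w i < w i')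
    (hd : (w * Equiv.swap j k) i' < (w * Equiv.swap j k) i) :
    (j = i ∧ k = i') ∨ (j = i' ∧ k = i) := by
  rcases lt_trichotomy j k with hjk | rfl | hjk
  · exact Or.inl (eq_of_cover_of_ascent_of_descent w hi hjk h hw hd)
  · rw [mul_swap_self] at h
    omega
  · rw [Equiv.swap_comm] at h hd
    exact Or.inr (eq_of_cover_of_ascent_of_descent w hi hjk h hw hd).symm

theorem chevalleyTerm_sub_rename (hS : IsDividedDifferenceFamily S)
    {w : Equiv.Perm (Fin n)} {i i' : Fin n} (hi : (i' : ℕ) = i + 1) (hw : w i < w i')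
    (j k : Fin n) :
    chevalleyTerm S (w * Equiv.swap i i') j k -
        rename (Equiv.swap i i') (chevalleyTerm S (w * Equiv.swap i i') j k) =
      (X i - X i') * (chevalleyTerm S w (Equiv.swap i i' j) (Equiv.swap i i' k) +
        (if j = i ∧ k = i' then -1 else if j = i' ∧ k = i then 1 else 0) *
          S (w * Equiv.swap i i')) := by
  have hlt : i < i' := by rw [Fin.lt_def]; omega
  have hv := invCount_mul_swap_of_lt w hi hw
  by_cases h1 : j = i ∧ k = i'
  · obtain ⟨rfl, rfl⟩ := h1
    simp [chevalleyTerm, mul_assoc, hv, Equiv.swap_comm k j, hlt, add_assoc]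
  by_cases h2 : j = i' ∧ k = i
  · obtain ⟨rfl, rfl⟩ := h2
    simp [chevalleyTerm, mul_assoc, hv, Equiv.swap_comm j k, hlt.not_gt, hlt.ne', add_assoc]
  rw [if_neg h1, if_neg h2, zero_mul, add_zero]
  rcases eq_or_ne j k with rfl | hjk
  · simp [chevalleyTerm_self]
  set s := Equiv.swap i i' with hs
  have hsp : ∀ p, s p = if p = i then i' else if p = i' then i else p :=
    fun p => Equiv.swap_apply_def i i' p
  have hc : (s k < s j) ↔ k < j := by
    rw [hsp, hsp, Fin.lt_def, Fin.lt_def]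
    grind
  have hconj : w * Equiv.swap (s j) (s k) = w * s * Equiv.swap j k * s := by
    rw [Equiv.swap_apply_apply, hs, Equiv.swap_inv]
    simp only [mul_assoc]
  unfold chevalleyTerm
  rw [hconj, hv]
  simp only [hc]
  set u := w * s * Equiv.swap j k with hu
  rcases lt_or_gt_of_ne (show u i ≠ u i' from fun h => hlt.ne (u.injective h)) with hui | hui
  · have hl := invCount_mul_swap_of_lt u hi hui
    have hr : rename s (S u) = S u := hS.rename_eq hi hui
    have hno : invCount (u * s) ≠ invCount w + 1 := by
      intro h
      have := eq_or_eq_of_cover_of_ascent_of_descent w hi (hconj ▸ h) hw (by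
        have e1 : s i = i' := Equiv.swap_apply_left i i'
        have e2 : s i' = i := Equiv.swap_apply_right i i'
        rw [hconj, Equiv.Perm.mul_apply, Equiv.Perm.mul_apply u s i, e1, e2]
        exact hui)
      rw [hsp, hsp] at this
      grind
    rw [if_neg hno, mul_zero]
    split_ifs <;> simp [hr]
  · have hl : invCount u = invCount (u * s) + 1 := invCount_mul_swap_of_gt u hi hui
    have hr : (X i - X i') * S (u * s) = S u - rename s (S u) := hS u i i' hi hui
    simp only [hl, add_left_inj]
    split_ifs
    · simp only [map_mul, map_one]
      linear_combination -hr
    · simp only [map_mul, map_neg, map_one]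
      linear_combination hr
    · simp

/-- The expansion of the product of a variable and a Schubert polynomial in the
coinvariant algebra. -/
theorem X_mul_sub_sum_chevalleyTerm_mem (hS : IsDividedDifferenceFamily S)
    (hS0 : S Fin.revPerm = ∏ i : Fin n, X i ^ (n - 1 - (i : ℕ)))
    (w : Equiv.Perm (Fin n)) (k : Fin n) :
    X k * S w - ∑ j, chevalleyTerm S w j k ∈
      Ideal.span {q : MvPolynomial (Fin n) ℂ | q.IsSymmetric ∧ constantCoeff q = 0} := by
  induction hN : invCount (Fin.revPerm : Equiv.Perm (Fin n)) - invCount w using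
    Nat.strong_induction_on generalizing w k with
  | _ N ih =>
  by_cases hw0 : w = Fin.revPerm
  · have hz : ∑ j, chevalleyTerm S w j k = 0 := by
      refine Finset.sum_eq_zero fun j _ => if_neg fun h => ?_
      have := invCount_le (w * Equiv.swap j k)
      rw [h, hw0] at this
      omega
    rw [hz, sub_zero, hw0, hS0, mul_comm]
    exact staircase_mul_X_mem k
  obtain ⟨i, i', hi, hw⟩ := exists_ascent w hw0
  have hv := invCount_mul_swap_of_lt w hi hw
  have hle := invCount_le (w * Equiv.swap i i')
  have hne : i ≠ i' := fun h => by rw [h] at hi; omega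
  have hmem := ih _ (by omega) (w * Equiv.swap i i') (Equiv.swap i i' k) rfl
  refine mem_coinvariantIdeal_of_dividedDifference hne hmem ?_
  have hr := hS (w * Equiv.swap i i') i i' hi (by simpa using hw)
  rw [mul_assoc w, Equiv.swap_mul_self, mul_one] at hr
  have hsum := Finset.sum_congr rfl fun j (_ : j ∈ Finset.univ) =>
    chevalleyTerm_sub_rename hS hi hw j (Equiv.swap i i' k)
  rw [Finset.sum_sub_distrib, ← map_sum, ← Finset.mul_sum, Finset.sum_add_distrib,
    ← Finset.sum_mul, Equiv.swap_apply_self,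
    Equiv.sum_comp (Equiv.swap i i') (fun j => chevalleyTerm S w j k)] at hsum
  have hcoef : (X i - X i') * ∑ j, (if j = i ∧ Equiv.swap i i' k = i' then -1
      else if j = i' ∧ Equiv.swap i i' k = i then 1 else 0 : MvPolynomial (Fin n) ℂ) =
        X (Equiv.swap i i' k) - X k := by
    by_cases h1 : k = i
    · subst h1
      simp [hne.symm]
    by_cases h2 : k = i'
    · subst h2
      simp [hne]
    simp [Equiv.swap_apply_of_ne_of_ne h1 h2, h1, h2]
  rw [map_sub, map_mul, rename_X, Equiv.swap_apply_self]
  linear_combination X k * hr + hsum + S (w * Equiv.swap i i') * hcoef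

end Chevalley

/-- Monk's rule modulo the ideal of symmetric polynomials with zero constant term.
Here `S : S_n → ℂ[x₁,…,xₙ]` is the family of Schubert polynomials, characterized by
`S w₀ = x₁^{n-1} x₂^{n-2} ⋯ x_{n-1}` and the divided-difference recursion
`(xᵢ - xᵢ₊₁) · 𝔖_{w sᵢ} = 𝔖_w - sᵢ·𝔖_w` when `ℓ(w sᵢ) < ℓ(w)`. -/
theorem monks_rule {n : ℕ} (S : Equiv.Perm (Fin n) → MvPolynomial (Fin n) ℂ)
    (hS0 : S Fin.revPerm = ∏ i : Fin n, X i ^ (n - 1 - (i : ℕ)))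
    (hSrec : ∀ (w : Equiv.Perm (Fin n)) (i : Fin n) (h : (i : ℕ) + 1 < n),
      invCount (w * Equiv.swap i ⟨(i : ℕ) + 1, h⟩) < invCount w →
      (X i - X ⟨(i : ℕ) + 1, h⟩) * S (w * Equiv.swap i ⟨(i : ℕ) + 1, h⟩) =
        S w - rename (Equiv.swap i ⟨(i : ℕ) + 1, h⟩) (S w))
    (w : Equiv.Perm (Fin n)) (m : Fin n) (hm : (m : ℕ) + 1 < n) :
    (∑ i ∈ Finset.univ.filter (fun i : Fin n => i ≤ m), X i) * S w -
      ∑ p ∈ Finset.univ.filter (fun p : Fin n × Fin n =>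
          p.1 ≤ m ∧ m < p.2 ∧ invCount (w * Equiv.swap p.1 p.2) = invCount w + 1),
        S (w * Equiv.swap p.1 p.2)
      ∈ Ideal.span {q : MvPolynomial (Fin n) ℂ | q.IsSymmetric ∧ constantCoeff q = 0} := by
  have hS : IsDividedDifferenceFamily S := by
    rintro v ⟨i, hi⟩ ⟨i', hi'⟩ h hv
    obtain rfl : i' = i + 1 := h
    refine hSrec v ⟨i, hi⟩ hi' ?_
    have := invCount_mul_swap_of_gt v (i := ⟨i, hi⟩) (i' := ⟨i + 1, hi'⟩) rfl hv
    simp only at this ⊢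
    omega
  have hmem := Ideal.sum_mem _ fun k (_ : k ∈ Finset.univ.filter (fun i : Fin n => i ≤ m)) =>
    X_mul_sub_sum_chevalleyTerm_mem hS hS0 w k
  rw [Finset.sum_sub_distrib, ← Finset.sum_mul] at hmem
  convert hmem using 2
  set A := Finset.univ.filter (fun i : Fin n => i ≤ m) with hA
  have hsplit : ∀ k ∈ A, ∑ j, chevalleyTerm S w j k =
      ∑ j ∈ A, chevalleyTerm S w j k + ∑ j ∈ Aᶜ, chevalleyTerm S w j k :=
    fun k _ => (Finset.sum_add_sum_compl A _).symm
  have hzero : ∑ k ∈ A, ∑ j ∈ A, chevalleyTerm S w j k = 0 := by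
    rw [← self_eq_neg]
    conv_lhs => rw [Finset.sum_comm]
    simp_rw [← Finset.sum_neg_distrib]
    exact Finset.sum_congr rfl fun j _ => Finset.sum_congr rfl fun k _ =>
      chevalleyTerm_antisymm w j k
  rw [Finset.sum_congr rfl hsplit, Finset.sum_add_distrib, hzero, zero_add,
    ← Finset.sum_product']
  have hfilter : Finset.univ.filter (fun p : Fin n × Fin n =>
      p.1 ≤ m ∧ m < p.2 ∧ invCount (w * Equiv.swap p.1 p.2) = invCount w + 1) =
      (A ×ˢ Aᶜ).filter (fun p => invCount (w * Equiv.swap p.1 p.2) = invCount w + 1) := by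
    ext p
    simp [hA, and_assoc]
  rw [hfilter, Finset.sum_filter]
  refine Finset.sum_congr rfl fun p hp => ?_
  simp only [Finset.mem_product, Finset.mem_compl, hA, Finset.mem_filter, Finset.mem_univ,
    true_and, not_le] at hp
  rw [chevalleyTerm, Equiv.swap_comm p.2 p.1, if_pos (hp.1.trans_lt hp.2), one_mul]
end
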